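/- arXiv:1710.06115 — 2 statements merged into one kernel-verified Lean document; each statement's English description precedes it below -/
import Mathlib

section
/- For any pair x ≤ w in S_n, the number of transpositions t with x < x·t ≤ w is at least ℓ(w) − ℓ(x). -/
open Equiv

/-- Rank function: `rk w i j = #{u = 1,...,i : w(u) ≤ j}` (1-based via `Fin`). -/
def rk {n : ℕ} (w : Equiv.Perm (Fin n)) (i j : ℕ) : ℕ :=
  (Finset.univ.filter (fun u : Fin n => u.val + 1 ≤ i ∧ (w u).val + 1 ≤ j)).card

/-- Coxeter length = number of inversions. -/
def len {n : ℕ} (w : Equiv.Perm (Fin n)) : ℕ :=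
  (Finset.univ.filter (fun p : Fin n × Fin n => p.1 < p.2 ∧ w p.2 < w p.1)).card

/-- A transposition. -/
def IsTransposition {n : ℕ} (t : Equiv.Perm (Fin n)) : Prop :=
  ∃ i j : Fin n, i ≠ j ∧ t = Equiv.swap i j

/-- Bruhat order: generated by `x → x·t` for transpositions `t` increasing the length. -/
def bruhatLE {n : ℕ} : Equiv.Perm (Fin n) → Equiv.Perm (Fin n) → Prop :=
  Relation.ReflTransGen (fun x y => ∃ t, IsTransposition t ∧ y = x * t ∧ len x < len y)

/-- Strict Bruhat order. -/
def bruhatLT {n : ℕ} (x y : Equiv.Perm (Fin n)) : Prop := bruhatLE x y ∧ x ≠ y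

/-- Difference function `d_w(p,p')`. -/
def dOf {n : ℕ} (w : Equiv.Perm (Fin n)) (p q : ℕ × ℕ) : ℤ :=
  (rk w p.1 p.2 : ℤ) + rk w q.1 q.2 - rk w p.1 q.2 - rk w q.1 p.2

/-- Strictly comparable points: `(i'−i)(j'−j) > 0`. -/
def SCmp (p q : ℕ × ℕ) : Prop := (p.1 < q.1 ∧ p.2 < q.2) ∨ (q.1 < p.1 ∧ q.2 < p.2)

/-- Corners of the rectangle spanned by `p`, `q`. -/
def corners (p q : ℕ × ℕ) : Set (ℕ × ℕ) := {(p.1, q.2), (q.1, p.2)}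

namespace DI

open Polynomial

variable {n : ℕ}

/-! ### Length and Bruhat order -/

theorem len_swap_lt (x : Perm (Fin n)) {a b : Fin n} (hab : a < b) (h : x a < x b) :
    len x < len (x * swap a b) := by
  classical
  set t := swap a b with ht
  have htt : ∀ k, t (t k) = k := fun k => by simp [ht]
  have hta : t a = b := by simp [ht]
  have htb : t b = a := by simp [ht]
  have hto : ∀ k, k ≠ a → k ≠ b → t k = k := fun k h1 h2 => swap_apply_of_ne_of_ne h1 h2
  unfold len
  let φ : Fin n × Fin n → Fin n × Fin n :=
    fun p => if t p.1 < t p.2 then (t p.1, t p.2) else p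
  have hmem : (a, b) ∈ Finset.univ.filter
      (fun p : Fin n × Fin n => p.1 < p.2 ∧ (x * t) p.2 < (x * t) p.1) := by
    rw [Finset.mem_filter]
    exact ⟨Finset.mem_univ _, hab, by simpa [hta, htb] using h⟩
  have hinj : Set.InjOn φ (Finset.univ.filter
      (fun p : Fin n × Fin n => p.1 < p.2 ∧ x p.2 < x p.1) : Finset (Fin n × Fin n)) := by
    rintro ⟨p, q⟩ hp ⟨p', q'⟩ hp' he
    simp only [Finset.coe_filter, Finset.mem_univ, true_and, Set.mem_ofPred_eq] at hp hp'
    simp only [φ] at he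
    split_ifs at he with h1 h2 h2
    · simpa using he
    · simp only [Prod.mk.injEq] at he
      obtain ⟨rfl, rfl⟩ := he
      rw [htt, htt] at h2
      exact absurd hp.1 h2
    · simp only [Prod.mk.injEq] at he
      obtain ⟨rfl, rfl⟩ := he
      rw [htt, htt] at h1
      exact absurd hp'.1 h1
    · exact he
  rw [← Finset.card_image_of_injOn hinj]
  apply Finset.card_lt_card
  rw [Finset.ssubset_iff_of_subset]
  · refine ⟨(a, b), hmem, ?_⟩
    simp only [Finset.mem_image, Finset.mem_filter, Finset.mem_univ, true_and, not_exists, not_and]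
    rintro ⟨p, q⟩ hp he
    simp only [φ] at he
    split_ifs at he with h1
    · simp only [Prod.mk.injEq] at he
      have e1 : p = b := by rw [← htt p, he.1, hta]
      have e2 : q = a := by rw [← htt q, he.2, htb]
      subst e1 e2
      exact absurd hp.1 (not_lt.2 hab.le)
    · simp only [Prod.mk.injEq] at he
      obtain ⟨rfl, rfl⟩ := he
      exact absurd hp.2 (not_lt.2 h.le)
  · intro r hr
    simp only [Finset.mem_image, Finset.mem_filter, Finset.mem_univ, true_and] at hr ⊢
    obtain ⟨⟨p, q⟩, ⟨hp1, hp2⟩, rfl⟩ := hr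
    simp only at hp1 hp2
    simp only [φ]
    split_ifs with h1
    · simpa [htt, h1] using hp2
    · refine ⟨hp1, ?_⟩
      simp only [Perm.coe_mul, Function.comp]
      by_cases pa : p = a
      · subst pa
        by_cases qb : q = b
        · subst qb; exact absurd hp2 (not_lt.2 h.le)
        · rw [hto q hp1.ne' qb, hta]; exact hp2.trans h
      · by_cases pb : p = b
        · subst pb
          rw [htb, hto q (hab.trans hp1).ne' hp1.ne'] at h1
          exact absurd (hab.trans hp1) h1
        · by_cases qb : q = b
          · subst qb
            rw [hto p pa pb, htb]; exact h.trans hp2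
          · by_cases qa : q = a
            · subst qa
              rw [hto p pa pb, hta] at h1
              exact absurd (hp1.trans hab) h1
            · rw [hto p pa pb, hto q qa qb]; exact hp2

theorem lt_of_len (x : Perm (Fin n)) {a b : Fin n} (hab : a < b)
    (h : len x < len (x * swap a b)) : x a < x b := by
  by_contra hc
  have hne : x a ≠ x b := fun e => hab.ne (x.injective e)
  have h2 : x b < x a := lt_of_le_of_ne (not_lt.1 hc) hne.symm
  have := len_swap_lt (x * swap a b) hab (by simpa using h2)
  rw [mul_assoc, swap_mul_self, mul_one] at this
  omega

/-- adjacent swap preserves order of other pairs -/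
theorem adj_lt {a b c e : Fin n} (hab : b.val = a.val + 1) (hce : c < e)
    (hne : ¬ (c = a ∧ e = b)) : swap a b c < swap a b e := by
  simp only [swap_apply_def]
  simp only [Fin.ext_iff, Fin.lt_def] at *
  split_ifs <;> simp_all <;> omega

theorem len_adj_le (x : Perm (Fin n)) {a b : Fin n} (hab : b.val = a.val + 1) :
    len (x * swap a b) ≤ len x + 1 := by
  classical
  unfold len
  set s := swap a b with hs
  have : (Finset.univ.filter (fun p : Fin n × Fin n => p.1 < p.2 ∧ (x * s) p.2 < (x * s) p.1)) ⊆
      insert (a, b) ((Finset.univ.filter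
        (fun p : Fin n × Fin n => p.1 < p.2 ∧ x p.2 < x p.1)).image
          (fun p => (s p.1, s p.2))) := by
    rintro ⟨p, q⟩ hp
    simp only [Finset.mem_filter, Finset.mem_univ, true_and] at hp
    simp only [Finset.mem_insert, Finset.mem_image, Finset.mem_filter, Finset.mem_univ, true_and]
    by_cases h : p = a ∧ q = b
    · left; rw [h.1, h.2]
    · right
      exact ⟨(s p, s q), ⟨adj_lt hab hp.1 h, hp.2⟩, by simp [hs]⟩
  refine (Finset.card_le_card this).trans ((Finset.card_insert_le _ _).trans ?_)
  exact Nat.add_le_add_right Finset.card_image_le 1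

theorem step_le (x : Perm (Fin n)) {a b : Fin n} (hab : a < b) (h : x a < x b) {w : Perm (Fin n)}
    (hw : bruhatLE (x * swap a b) w) : bruhatLE x w :=
  Relation.ReflTransGen.head ⟨swap a b, ⟨a, b, hab.ne, rfl⟩, rfl, len_swap_lt x hab h⟩ hw

theorem le_ind {w : Perm (Fin n)} {P : Perm (Fin n) → Prop} (h0 : P w)
    (hs : ∀ x (a b : Fin n), a < b → x a < x b → bruhatLE (x * swap a b) w →
      P (x * swap a b) → P x) {x : Perm (Fin n)} (hx : bruhatLE x w) : P x := by
  refine Relation.ReflTransGen.head_induction_on hx h0 ?_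
  rintro x y ⟨t, ⟨a, b, hab, rfl⟩, rfl, hl⟩ hy hP
  rcases lt_or_gt_of_ne hab with h | h
  · exact hs x a b h (lt_of_len x h hl) hy hP
  · have e : swap a b = swap b a := swap_comm a b
    rw [e] at hl hy hP
    exact hs x b a h (lt_of_len x h hl) hy hP

theorem len_le {x w : Perm (Fin n)} (h : bruhatLE x w) : len x ≤ len w :=
  le_ind (P := fun x => len x ≤ len w) le_rfl
    (fun x _ _ hab h _ ih => (len_swap_lt x hab h).le.trans ih) h

theorem swap_conj (s t : Fin n) (x : Perm (Fin n)) (c e : Fin n) :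
    x * swap s t * swap (swap s t c) (swap s t e) = x * swap c e * swap s t := by
  rw [mul_assoc, mul_swap_eq_swap_mul (swap s t)]
  simp [mul_assoc]

theorem lift_A {w : Perm (Fin n)} {a b : Fin n} (hab : b.val = a.val + 1) (hw : w a < w b)
    {y : Perm (Fin n)} (hy : bruhatLE y w) :
    bruhatLE y (w * swap a b) ∧ bruhatLE (y * swap a b) (w * swap a b) := by
  have hlt : a < b := by rw [Fin.lt_def]; omega
  have hup : ∀ {z}, bruhatLE z w → bruhatLE z (w * swap a b) := fun {z} hz =>
    hz.trans (step_le w hlt hw Relation.ReflTransGen.refl)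
  refine ⟨hup hy, ?_⟩
  refine le_ind (P := fun y => bruhatLE (y * swap a b) (w * swap a b))
    Relation.ReflTransGen.refl ?_ hy
  intro x c e hce hx hle ih
  by_cases h : c = a ∧ e = b
  · rw [h.1, h.2] at hle
    exact hup hle
  · refine step_le (x * swap a b) (adj_lt hab hce h) (by simpa using hx) ?_
    rw [swap_conj]
    exact ih

theorem lift_B {w : Perm (Fin n)} {a b : Fin n} (hab : b.val = a.val + 1) (hw : w b < w a)
    {y : Perm (Fin n)} (hy : bruhatLE y w) : bruhatLE (y * swap a b) w := by
  have hlt : a < b := by rw [Fin.lt_def]; omega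
  have hdown : bruhatLE (w * swap a b) w := by
    refine step_le (w * swap a b) hlt (by simpa using hw) ?_
    rw [mul_assoc, swap_mul_self, mul_one]
    exact Relation.ReflTransGen.refl
  refine le_ind (P := fun y => bruhatLE (y * swap a b) w) hdown ?_ hy
  intro x c e hce hx hle ih
  by_cases h : c = a ∧ e = b
  · rw [h.1, h.2] at hle
    exact hle
  · refine step_le (x * swap a b) (adj_lt hab hce h) (by simpa using hx) ?_
    rw [swap_conj]
    exact ih

/-! ### The numbers -/

def u (i : Fin n) : ℚ := 2 ^ (i : ℕ)

theorem u_lt {i j : Fin n} (h : i < j) : u i < u j := by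
  unfold u
  exact pow_lt_pow_right₀ (by norm_num) h

theorem u_pos (i : Fin n) : 0 < u i := by unfold u; positivity

theorem pow_aux {i j k l : ℕ} (hij : i < j) (hkl : k < l) (h : 2 ^ i + 2 ^ j = 2 ^ k + 2 ^ l) :
    i = k ∧ j = l := by
  have key : ∀ {i j k l : ℕ}, i < j → 2 ^ i + 2 ^ j = 2 ^ k + 2 ^ l → l ≤ j := by
    intro i j k l hij h
    by_contra hc
    have h1 : 2 ^ i < 2 ^ j := Nat.pow_lt_pow_right (by norm_num) hij
    have h2 : 2 ^ (j + 1) ≤ 2 ^ l := Nat.pow_le_pow_right (by norm_num) (by omega)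
    have h3 : 0 < 2 ^ k := by positivity
    rw [pow_succ] at h2
    omega
  have e : j = l := le_antisymm (key hkl h.symm) (key hij h)
  subst e
  exact ⟨Nat.pow_right_injective le_rfl (by simpa using h), rfl⟩

theorem u_sum {i j k l : Fin n} (hij : i ≠ j) (hkl : k ≠ l) (h : u i + u j = u k + u l) :
    swap i j = swap k l := by
  have key : ∀ {i j k l : Fin n}, i < j → k < l → u i + u j = u k + u l → swap i j = swap k l := by
    intro i j k l hij hkl h
    unfold u at h
    have := pow_aux hij hkl (by exact_mod_cast h)
    rw [Fin.ext this.1, Fin.ext this.2]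
  rcases lt_or_gt_of_ne hij with h1 | h1 <;> rcases lt_or_gt_of_ne hkl with h2 | h2
  · exact key h1 h2 h
  · rw [swap_comm k]; exact key h1 h2 (by linarith)
  · rw [swap_comm i]; exact key h1 h2 (by linarith)
  · rw [swap_comm i, swap_comm k]; exact key h1 h2 (by linarith)

def ze (i j : Fin n) : ℚ := -(u i + u j)

noncomputable def V (i : Fin n) : ℚ[X] := C (u i) * X + C (u i ^ 2)

theorem V_sub (i j : Fin n) : V j - V i = C (u j - u i) * (X - C (ze i j)) := by
  simp only [V, ze, C_sub, C_neg, C_add, C_pow]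
  ring

theorem V_eval (x : Perm (Fin n)) (c e k : Fin n) :
    (V (x (swap c e k))).eval (ze (x c) (x e)) = (V (x k)).eval (ze (x c) (x e)) := by
  have : (V (x c)).eval (ze (x c) (x e)) = (V (x e)).eval (ze (x c) (x e)) := by
    simp [V, ze]; ring
  by_cases h1 : k = c
  · subst h1; simp [this]
  · by_cases h2 : k = e
    · subst h2; simp [this]
    · rw [swap_apply_of_ne_of_ne h1 h2]

/-- pairs -/
def prs (n : ℕ) : Finset (Fin n × Fin n) := Finset.univ.filter (fun p => p.1 < p.2)

def GKM (d : Perm (Fin n) → ℚ[X]) : Prop :=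
  ∀ x (c e : Fin n), c ≠ e →
    (d x).eval (ze (x c) (x e)) = (d (x * swap c e)).eval (ze (x c) (x e))

def DegB (m : ℕ) (d : Perm (Fin n) → ℚ[X]) : Prop :=
  ∀ x, d x ≠ 0 → (d x).natDegree + m ≤ (prs n).card

theorem swap_inj {a b c e : Fin n} (h1 : a < b) (h2 : c < e) (h : swap a b = swap c e) :
    a = c ∧ b = e := by
  have ha : swap c e a = b := by rw [← h]; simp
  simp only [swap_apply_def] at ha
  split_ifs at ha with h3 h4
  · exact ⟨h3, ha.symm⟩
  · subst h4 ha; exact absurd h1 (not_lt.2 h2.le)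
  · exact absurd ha h1.ne

theorem count {d : Perm (Fin n) → ℚ[X]} {m : ℕ} (hg : GKM d) (hd : DegB m d)
    {x : Perm (Fin n)} (hx : d x ≠ 0) :
    m ≤ ((prs n).filter (fun p => d (x * swap p.1 p.2) ≠ 0)).card := by
  classical
  have h1 := hd x hx
  have h2 : ((prs n).filter (fun p => ¬ d (x * swap p.1 p.2) ≠ 0)).card ≤ (d x).natDegree := by
    have hinj : Set.InjOn (fun p : Fin n × Fin n => ze (x p.1) (x p.2))
        ((prs n).filter (fun p => ¬ d (x * swap p.1 p.2) ≠ 0) : Finset (Fin n × Fin n)) := by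
      rintro ⟨a, b⟩ hp ⟨c, e⟩ hq h
      simp only [prs, Finset.coe_filter, Finset.mem_filter, Finset.mem_univ, true_and,
        Set.mem_ofPred_eq] at hp hq
      simp only [ze, neg_inj] at h
      have := u_sum (fun e => hp.1.ne (x.injective e)) (fun e => hq.1.ne (x.injective e)) h
      have h5 : x * swap a b = x * swap c e := by
        rw [mul_swap_eq_swap_mul, mul_swap_eq_swap_mul, this]
      have := swap_inj hp.1 hq.1 (mul_left_cancel h5)
      rw [this.1, this.2]
    rw [← Finset.card_image_of_injOn hinj]
    refine (Finset.card_le_card ?_).trans ((Multiset.toFinset_card_le _).trans (card_roots' (d x)))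
    intro r hr
    simp only [Finset.mem_image, Finset.mem_filter] at hr
    obtain ⟨⟨a, b⟩, ⟨hp, hq⟩, rfl⟩ := hr
    simp only [prs, Finset.mem_filter, Finset.mem_univ, true_and] at hp
    rw [Multiset.mem_toFinset, mem_roots hx, IsRoot.def, hg x a b hp.ne, not_not.1 hq, eval_zero]
  have h3 := Finset.card_filter_add_card_filter_not (s := prs n)
    (fun p => d (x * swap p.1 p.2) ≠ 0)
  omega

theorem exists_partial {d : Perm (Fin n) → ℚ[X]} {m : ℕ} (hg : GKM d) (hd : DegB m d)
    {a b : Fin n} (hab : a ≠ b) :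
    ∃ d' : Perm (Fin n) → ℚ[X],
      (∀ x, d x - d (x * swap a b) = (V (x b) - V (x a)) * d' x) ∧ GKM d' ∧ DegB (m + 1) d' := by
  have hne : ∀ x : Perm (Fin n), u (x b) - u (x a) ≠ 0 := by
    intro x h
    have : x a ≠ x b := fun e => hab (x.injective e)
    rcases lt_or_gt_of_ne this with h1 | h1
    · have := u_lt h1; linarith
    · have := u_lt h1; linarith
  have hV : ∀ x : Perm (Fin n), V (x b) - V (x a) ≠ 0 := by
    intro x
    rw [V_sub]
    exact mul_ne_zero (C_ne_zero.2 (hne x)) (X_sub_C_ne_zero _)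
  have hex : ∀ x, ∃ q, d x - d (x * swap a b) = (V (x b) - V (x a)) * q := by
    intro x
    have : (X - C (ze (x a) (x b))) ∣ d x - d (x * swap a b) := by
      rw [dvd_iff_isRoot, IsRoot.def, eval_sub, hg x a b hab, sub_self]
    obtain ⟨q, hq⟩ := this
    refine ⟨C (u (x b) - u (x a))⁻¹ * q, ?_⟩
    rw [V_sub, hq]
    have : C (u (x b) - u (x a)) * C (u (x b) - u (x a))⁻¹ = (1 : ℚ[X]) := by
      rw [← C_mul, mul_inv_cancel₀ (hne x), C_1]
    linear_combination (-(X - C (ze (x a) (x b))) * q) * this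
  choose d' hd' using hex
  refine ⟨d', hd', ?_, ?_⟩
  · intro x c e hce
    by_cases hs : swap c e = swap a b
    · rw [hs]
      have h1 := hd' x
      have h2 := hd' (x * swap a b)
      rw [mul_assoc, swap_mul_self, mul_one] at h2
      simp only [Perm.coe_mul, Function.comp, swap_apply_left, swap_apply_right] at h2
      have : d' x = d' (x * swap a b) := by
        apply mul_left_cancel₀ (hV x)
        linear_combination -h1 - h2
      rw [this]
    · set z := ze (x c) (x e) with hz
      have h1 := congrArg (eval z) (hd' x)
      have h2 := congrArg (eval z) (hd' (x * swap c e))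
      simp only [eval_sub, eval_mul, Perm.coe_mul, Function.comp] at h1 h2
      rw [hz, V_eval, V_eval, ← hz] at h2
      have h3 := hg x c e hce
      have h4 := hg (x * swap a b) (swap a b c) (swap a b e) (fun h => hce ((swap a b).injective h))
      rw [swap_conj] at h4
      simp only [Perm.coe_mul, Function.comp, swap_apply_self] at h4
      rw [← hz] at h3 h4
      have h5 : eval z (V (x b)) - eval z (V (x a)) ≠ 0 := by
        rw [← eval_sub, V_sub]
        simp only [eval_mul, eval_C, eval_sub, eval_X]
        refine mul_ne_zero (hne x) (fun h => hs ?_)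
        simp only [hz, ze] at h
        have := u_sum (i := x c) (j := x e) (k := x a) (l := x b)
          (fun e => hce (x.injective e)) (fun e => hab (x.injective e)) (by linarith)
        apply mul_left_cancel (a := x)
        rw [mul_swap_eq_swap_mul, mul_swap_eq_swap_mul, this]
      apply mul_left_cancel₀ h5
      rw [← h1, ← h2, h3, h4]
  · intro x hx
    have h1 := hd' x
    have hdeg : (d x - d (x * swap a b)).natDegree = 1 + (d' x).natDegree := by
      rw [h1, natDegree_mul (hV x) hx, V_sub, natDegree_C_mul (hne x), natDegree_X_sub_C]
    have h2 := natDegree_sub_le (d x) (d (x * swap a b))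
    have h3 : d x ≠ 0 ∨ d (x * swap a b) ≠ 0 := by
      by_contra hc
      push Not at hc
      rw [hc.1, hc.2, sub_self] at h1
      exact mul_ne_zero (hV x) hx h1.symm
    rw [hdeg, le_max_iff] at h2
    by_cases e1 : d x = 0
    · have e2 : d (x * swap a b) ≠ 0 := by tauto
      have := hd _ e2
      rw [e1, natDegree_zero] at h2
      omega
    · have := hd _ e1
      by_cases e2 : d (x * swap a b) = 0
      · rw [e2, natDegree_zero] at h2
        omega
      · have := hd _ e2
        omega

structure Nice (w : Perm (Fin n)) (d : Perm (Fin n) → ℚ[X]) : Prop where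
  gkm : GKM d
  deg : DegB (len w) d
  supp : ∀ x, d x ≠ 0 → bruhatLE x w
  top : 0 < (d w).eval 0

theorem V_pos {i j : Fin n} (h : i < j) : 0 < (V j - V i).eval 0 := by
  have h1 := u_lt h
  have h2 := u_pos i
  simp only [V, eval_sub, eval_add, eval_mul, eval_C, eval_X]
  nlinarith

theorem nice_step {w : Perm (Fin n)} {d : Perm (Fin n) → ℚ[X]} (hd : Nice w d)
    {a b : Fin n} (hab : b.val = a.val + 1) (hw : w a < w b) :
    ∃ d', (∀ x, d x - d (x * swap a b) = (V (x b) - V (x a)) * d' x) ∧ Nice (w * swap a b) d' := by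
  have hlt : a < b := by rw [Fin.lt_def]; omega
  obtain ⟨d', h1, h2, h3⟩ := exists_partial hd.gkm hd.deg hlt.ne
  refine ⟨d', h1, h2, ?_, ?_, ?_⟩
  · intro x hx
    have := h3 x hx
    have := len_adj_le w hab
    omega
  · intro x hx
    by_cases e1 : d x = 0
    · have e2 : d (x * swap a b) ≠ 0 := by
        intro e2
        have := h1 x
        rw [e1, e2, sub_self] at this
        rcases mul_eq_zero.1 this.symm with h | h
        · rw [V_sub] at h
          rcases mul_eq_zero.1 h with h | h
          · have hne : x a ≠ x b := fun e => hlt.ne (x.injective e)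
            rw [C_eq_zero] at h
            rcases lt_or_gt_of_ne hne with h' | h'
            · have := u_lt h'; linarith
            · have := u_lt h'; linarith
          · exact X_sub_C_ne_zero _ h
        · exact hx h
      have := (lift_A hab hw (hd.supp _ e2)).2
      rwa [mul_assoc, swap_mul_self, mul_one] at this
    · exact (lift_A hab hw (hd.supp _ e1)).1
  · have e0 : d (w * swap a b) = 0 := by
      by_contra h
      have := len_le (hd.supp _ h)
      have := len_swap_lt w hlt hw
      omega
    have h4 := congrArg (eval 0) (h1 (w * swap a b))
    rw [mul_assoc, swap_mul_self, mul_one, e0] at h4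
    simp only [Perm.coe_mul, Function.comp, swap_apply_left, swap_apply_right] at h4
    rw [zero_sub, eval_neg, eval_mul] at h4
    have h5 := V_pos hw
    have h6 := hd.top
    rw [eval_sub] at h4 h5
    by_contra hc
    push Not at hc
    nlinarith

theorem exists_desc_or {w : Perm (Fin n)} :
    w = 1 ∨ ∃ a b : Fin n, b.val = a.val + 1 ∧ w b < w a := by
  by_cases h : ∃ a b : Fin n, b.val = a.val + 1 ∧ w b < w a
  · exact Or.inr h
  · left
    push Not at h
    have hm : Monotone w := by
      cases n with
      | zero => intro a; exact a.elim0
      | succ m =>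
        rw [Fin.monotone_iff_le_succ]
        intro i
        exact h _ _ (by simp)
    have hsm : StrictMono w := hm.strictMono_of_injective w.injective
    ext i
    have := congrFun (Subsingleton.elim (hsm.orderIsoOfSurjective w w.surjective)
      (OrderIso.refl _) ▸ rfl : ⇑(hsm.orderIsoOfSurjective w w.surjective) = id) i
    simpa using congrArg Fin.val this

theorem exists_nice (w : Perm (Fin n)) : ∃ d, Nice w d := by
  induction hk : len w using Nat.strong_induction_on generalizing w with
  | _ k ih =>
  rcases exists_desc_or (w := w) with rfl | ⟨a, b, hab, hw⟩
  · classical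
    have hl : len (1 : Perm (Fin n)) = 0 := by
      simp only [len, Finset.card_eq_zero, Finset.filter_eq_empty_iff]
      rintro ⟨p, q⟩ - h
      exact absurd h.1 (not_lt.2 h.2.le)
    let N : ℚ[X] := ∏ p ∈ prs n, (X - C (ze p.1 p.2))
    have hN : ∀ c e : Fin n, c ≠ e → N.eval (ze c e) = 0 := by
      intro c e hce
      rw [eval_prod, Finset.prod_eq_zero_iff]
      rcases lt_or_gt_of_ne hce with h | h
      · exact ⟨(c, e), by simp [prs, h], by simp⟩
      · exact ⟨(e, c), by simp [prs, h], by simp [ze]; ring⟩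
    refine ⟨fun x => if x = 1 then N else 0, ?_, ?_, ?_, ?_⟩
    · intro x c e hce
      have h0 : N.eval (ze (x c) (x e)) = 0 := hN _ _ (fun h => hce (x.injective h))
      simp only
      split_ifs <;> simp [h0]
    · intro x hx
      simp only at hx ⊢
      split_ifs at hx ⊢ with h
      · rw [hl]
        simp only [N]
        rw [natDegree_prod_of_monic _ _ (fun p _ => monic_X_sub_C _)]
        simp
      · exact absurd rfl hx
    · intro x hx
      by_cases h : x = 1
      · rw [h]; exact Relation.ReflTransGen.refl
      · simp [h] at hx
    · simp only [if_true, N, eval_prod]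
      refine Finset.prod_pos fun p _ => ?_
      have h1 := u_pos p.1
      have h2 := u_pos p.2
      simp only [eval_sub, eval_X, eval_C, ze]
      linarith
  · have hlt : a < b := by rw [Fin.lt_def]; omega
    have h1 : (w * swap a b) a < (w * swap a b) b := by simpa using hw
    have h2 := len_swap_lt _ hlt h1
    have e : w * swap a b * swap a b = w := by rw [mul_assoc, swap_mul_self, mul_one]
    rw [e] at h2
    obtain ⟨d, hd⟩ := ih _ (hk ▸ h2) (w * swap a b) rfl
    obtain ⟨d', -, h⟩ := nice_step hd hab h1
    rw [e] at h
    exact ⟨d', h⟩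

theorem nice_inv {w : Perm (Fin n)} {d : Perm (Fin n) → ℚ[X]} (hd : Nice w d)
    {a b : Fin n} (hab : b.val = a.val + 1) (hw : w b < w a) (x : Perm (Fin n)) :
    d x = d (x * swap a b) := by
  classical
  have hlt : a < b := by rw [Fin.lt_def]; omega
  obtain ⟨d', h1, h2, h3⟩ := exists_partial hd.gkm hd.deg hlt.ne
  rw [← sub_eq_zero, h1 x]
  suffices h : ∀ y, d' y = 0 by rw [h, mul_zero]
  by_contra hc
  push Not at hc
  obtain ⟨y0, hy0⟩ := hc
  have hcases : ∀ y, d' y ≠ 0 → d' y * (V (y b) - V (y a)) ≠ 0 := by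
    intro y hy
    refine mul_ne_zero hy (fun h => ?_)
    have hne : y a ≠ y b := fun e => hlt.ne (y.injective e)
    rcases lt_or_gt_of_ne hne with h' | h'
    · have := V_pos h'; rw [h] at this; simp at this
    · have := V_pos h'; rw [← neg_sub, h] at this; simp at this
  have hsupp : ∀ y, d' y ≠ 0 → bruhatLE y w := by
    intro y hy
    by_cases e1 : d y = 0
    · by_cases e2 : d (y * swap a b) = 0
      · have h4 := h1 y
        rw [e1, e2, sub_self, mul_comm] at h4
        exact absurd h4.symm (hcases y hy)
      · have := lift_B hab hw (hd.supp _ e2)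
        rwa [mul_assoc, swap_mul_self, mul_one] at this
    · exact hd.supp _ e1
  obtain ⟨v, hv, hmax⟩ := Finset.exists_max_image (Finset.univ.filter (fun y => d' y ≠ 0)) len
    ⟨y0, by simpa using hy0⟩
  simp only [Finset.mem_filter, Finset.mem_univ, true_and] at hv hmax
  have h4 := count h2 h3 hv
  have h5 : ((prs n).filter (fun p => d' (v * swap p.1 p.2) ≠ 0)).card ≤ len v := by
    unfold len
    apply Finset.card_le_card
    rintro ⟨p, q⟩ hp
    simp only [prs, Finset.mem_filter, Finset.mem_univ, true_and] at hp ⊢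
    refine ⟨hp.1, ?_⟩
    by_contra hc
    have hne : v p ≠ v q := fun e => hp.1.ne (v.injective e)
    have := len_swap_lt v hp.1 (lt_of_le_of_ne (not_lt.1 hc) hne)
    have := hmax _ hp.2
    omega
  have h6 := len_le (hsupp v hv)
  omega

theorem len_bound (x : Perm (Fin n)) : len x ≤ (prs n).card := by
  unfold len prs
  apply Finset.card_le_card
  intro p hp
  simp only [Finset.mem_filter, Finset.mem_univ, true_and] at hp ⊢
  exact hp.1

theorem nice_pos (x : Perm (Fin n)) : ∀ (w : Perm (Fin n)) (d : Perm (Fin n) → ℚ[X]),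
    Nice w d → bruhatLE x w → 0 < (d x).eval 0 := by
  induction hk : (prs n).card - len x using Nat.strong_induction_on generalizing x with
  | _ k ih =>
  intro w d hd hx
  by_cases hasc : ∃ a b : Fin n, b.val = a.val + 1 ∧ x a < x b
  · obtain ⟨a, b, hab, hxa⟩ := hasc
    have hlt : a < b := by rw [Fin.lt_def]; omega
    have hl := len_swap_lt x hlt hxa
    have hb := len_bound (x * swap a b)
    have IH := ih _ (by omega) (x * swap a b) rfl
    have hne : w a ≠ w b := fun e => hlt.ne (w.injective e)
    rcases lt_or_gt_of_ne hne with h | h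
    · obtain ⟨d', h1, hd'⟩ := nice_step hd hab h
      have h2 := nice_inv hd' hab (by simpa using h) x
      have h3 := IH _ _ hd' (lift_A hab h hx).2
      rw [← h2] at h3
      have h4 : 0 ≤ (d (x * swap a b)).eval 0 := by
        by_cases e : d (x * swap a b) = 0
        · simp [e]
        · exact (IH _ _ hd (hd.supp _ e)).le
      have h5 := congrArg (eval 0) (h1 x)
      rw [eval_mul, eval_sub] at h5
      have h6 := mul_pos (V_pos hxa) h3
      linarith
    · rw [nice_inv hd hab h x]
      exact IH _ _ hd (lift_B hab h hx)
  · push Not at hasc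
    have hanti : Antitone x := by
      cases n with
      | zero => intro a; exact a.elim0
      | succ m =>
        rw [Fin.antitone_iff_succ_le]
        intro i
        exact hasc _ _ (by simp)
    have : x = w := by
      refine le_ind (P := fun y => Antitone y → y = w) (fun _ => rfl) ?_ hx hanti
      intro y a b hab h _ _ hy
      exact absurd h (not_lt.2 (hy hab.le))
    rw [this]
    exact hd.top

theorem main (x w : Perm (Fin n)) (hxw : bruhatLE x w) :
    len w ≤ len x + Set.ncard {t : Equiv.Perm (Fin n) |
        IsTransposition t ∧ bruhatLT x (x * t) ∧ bruhatLE (x * t) w} := by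
  classical
  obtain ⟨d, hd⟩ := exists_nice w
  have hx : d x ≠ 0 := by
    intro h
    have := nice_pos x w d hd hxw
    simp [h] at this
  have h1 := count hd.gkm hd.deg hx
  refine h1.trans ?_
  have h2 := Finset.card_filter_add_card_filter_not
    (s := (prs n).filter (fun p => d (x * swap p.1 p.2) ≠ 0)) (fun p => x p.2 < x p.1)
  rw [← h2]
  apply add_le_add
  · unfold len
    apply Finset.card_le_card
    rintro ⟨p, q⟩ hp
    simp only [prs, Finset.mem_filter, Finset.mem_univ, true_and] at hp ⊢
    exact ⟨hp.1.1, hp.2⟩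
  · rw [← Set.ncard_coe_finset]
    refine Set.ncard_le_ncard_of_injOn (fun p => swap p.1 p.2) ?_ ?_ (Set.toFinite _)
    · rintro ⟨p, q⟩ hp
      simp only [prs, Finset.coe_filter, Finset.mem_filter, Finset.mem_univ, true_and,
        Set.mem_ofPred_eq] at hp ⊢
      obtain ⟨⟨h3, h4⟩, h5⟩ := hp
      have hne : x p ≠ x q := fun e => h3.ne (x.injective e)
      have h6 := lt_of_le_of_ne (not_lt.1 h5) hne
      refine ⟨⟨p, q, h3.ne, rfl⟩, ⟨step_le x h3 h6 Relation.ReflTransGen.refl, ?_⟩,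
        hd.supp _ h4⟩
      intro h
      have := len_swap_lt x h3 h6
      rw [← h] at this
      omega
    · rintro ⟨p, q⟩ hp ⟨p', q'⟩ hq h
      simp only [prs, Finset.coe_filter, Finset.mem_filter, Finset.mem_univ, true_and,
        Set.mem_ofPred_eq] at hp hq
      have := swap_inj hp.1.1 hq.1.1 h
      rw [this.1, this.2]

end DI

theorem stmt8 (n : ℕ) (x w : Equiv.Perm (Fin n)) (hxw : bruhatLE x w) :
    (len w : ℤ) - len x ≤
      Set.ncard {t : Equiv.Perm (Fin n) |
        IsTransposition t ∧ bruhatLT x (x * t) ∧ bruhatLE (x * t) w} := by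
  have h := DI.main x w hxw
  omega
end

section
/- Every smooth pair (w,x) in S_n × S_n with x ≤ w is tight: if (w,x) satisfies #{t transposition : x < x·t ≤ w} = ℓ(w) − ℓ(x), then for every y ∈ S_n such that rk_y(p) = rk_w(p) for all points p with rk_x(p) = rk_w(p), one has y ≤ w. -/
open Equiv

namespace Tight

/-- Rank function with integer coordinates. -/
def R {n : ℕ} (w : Equiv.Perm (Fin n)) (s t : ℤ) : ℤ :=
  ∑ u : Fin n, if ((u : ℕ) : ℤ) < s ∧ ((w u : ℕ) : ℤ) < t then 1 else 0

lemma R_eq_rk {n : ℕ} (w : Equiv.Perm (Fin n)) (i j : ℕ) : R w i j = rk w i j := by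
  unfold R rk
  rw [Finset.card_filter]
  push_cast
  apply Finset.sum_congr rfl
  intro u _
  apply if_congr _ rfl rfl
  omega

lemma R_rect {n : ℕ} (w : Equiv.Perm (Fin n)) {s1 s2 t1 t2 : ℤ} (hs : s1 ≤ s2) (ht : t1 ≤ t2) :
    R w s2 t2 + R w s1 t1 - R w s1 t2 - R w s2 t1 =
      ∑ u : Fin n, if (s1 ≤ ((u : ℕ) : ℤ) ∧ ((u : ℕ) : ℤ) < s2) ∧
        (t1 ≤ ((w u : ℕ) : ℤ) ∧ ((w u : ℕ) : ℤ) < t2) then 1 else 0 := by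
  unfold R
  rw [← Finset.sum_add_distrib, ← Finset.sum_sub_distrib, ← Finset.sum_sub_distrib]
  apply Finset.sum_congr rfl
  intro u _
  split_ifs <;> omega

lemma R_rect_nonneg {n : ℕ} (w : Equiv.Perm (Fin n)) {s1 s2 t1 t2 : ℤ} (hs : s1 ≤ s2)
    (ht : t1 ≤ t2) : 0 ≤ R w s2 t2 + R w s1 t1 - R w s1 t2 - R w s2 t1 := by
  rw [R_rect w hs ht]
  apply Finset.sum_nonneg
  intro u _
  split_ifs <;> omega

lemma R_rect_dot {n : ℕ} (w : Equiv.Perm (Fin n)) {s1 s2 t1 t2 : ℤ} (hs : s1 ≤ s2)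
    (ht : t1 ≤ t2) (h : 0 < R w s2 t2 + R w s1 t1 - R w s1 t2 - R w s2 t1) :
    ∃ u : Fin n, (s1 ≤ ((u : ℕ) : ℤ) ∧ ((u : ℕ) : ℤ) < s2) ∧
        (t1 ≤ ((w u : ℕ) : ℤ) ∧ ((w u : ℕ) : ℤ) < t2) := by
  by_contra hc
  push Not at hc
  rw [R_rect w hs ht, Finset.sum_eq_zero] at h
  · exact lt_irrefl _ h
  · intro u _
    rw [if_neg]
    rintro ⟨h1, h2⟩
    have := hc u h1 h2.1
    omega

lemma R_rect_pos {n : ℕ} (w : Equiv.Perm (Fin n)) {s1 s2 t1 t2 : ℤ} (u : Fin n)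
    (h1 : s1 ≤ ((u : ℕ) : ℤ)) (h2 : ((u : ℕ) : ℤ) < s2)
    (h3 : t1 ≤ ((w u : ℕ) : ℤ)) (h4 : ((w u : ℕ) : ℤ) < t2) :
    0 < R w s2 t2 + R w s1 t1 - R w s1 t2 - R w s2 t1 := by
  rw [R_rect w (by omega) (by omega)]
  apply Finset.sum_pos'
  · intro u _
    split_ifs <;> omega
  · exact ⟨u, Finset.mem_univ _, by rw [if_pos ⟨⟨h1, h2⟩, h3, h4⟩]; norm_num⟩

lemma R_low {n : ℕ} (w : Equiv.Perm (Fin n)) {s t : ℤ} (h : s ≤ 0 ∨ t ≤ 0) : R w s t = 0 := by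
  unfold R
  apply Finset.sum_eq_zero
  intro u _
  rw [if_neg]; omega

lemma R_high {n : ℕ} (v w : Equiv.Perm (Fin n)) {s t : ℤ} (h : (n : ℤ) ≤ s ∨ (n : ℤ) ≤ t) :
    R v s t = R w s t := by
  rcases h with h | h
  · have key : ∀ v : Equiv.Perm (Fin n), R v s t = ∑ u : Fin n, if ((u : ℕ) : ℤ) < t then 1 else 0 := by
      intro v
      unfold R
      rw [← Equiv.sum_comp v (fun u : Fin n => if ((u : ℕ) : ℤ) < t then (1 : ℤ) else 0)]
      apply Finset.sum_congr rfl
      intro u _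
      apply if_congr _ rfl rfl
      have := u.2
      omega
    rw [key v, key w]
  · unfold R
    apply Finset.sum_congr rfl
    intro u _
    apply if_congr _ rfl rfl
    have := (v u).2
    have := (w u).2
    omega

lemma sum_split {n : ℕ} {a b : Fin n} (hab : a ≠ b) (g : Fin n → ℤ) :
    ∑ u, g u = g a + g b + ∑ u ∈ ({a, b} : Finset (Fin n))ᶜ, g u := by
  rw [← Finset.sum_add_sum_compl ({a, b} : Finset (Fin n)), Finset.sum_pair hab]

lemma swap_a {n : ℕ} (w : Equiv.Perm (Fin n)) (a b : Fin n) : (w * Equiv.swap a b) a = w b := by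
  simp
lemma swap_b {n : ℕ} (w : Equiv.Perm (Fin n)) (a b : Fin n) : (w * Equiv.swap a b) b = w a := by
  simp
lemma swap_c {n : ℕ} (w : Equiv.Perm (Fin n)) (a b c : Fin n) (h1 : c ≠ a) (h2 : c ≠ b) :
    (w * Equiv.swap a b) c = w c := by
  simp [Equiv.swap_apply_of_ne_of_ne h1 h2]

lemma R_swap {n : ℕ} (w : Equiv.Perm (Fin n)) {a b : Fin n} (hab : a < b) (hw : w a < w b)
    (s t : ℤ) : R (w * Equiv.swap a b) s t = R w s t -
      if (((a : ℕ) : ℤ) < s ∧ s ≤ ((b : ℕ) : ℤ)) ∧ (((w a : ℕ) : ℤ) < t ∧ t ≤ ((w b : ℕ) : ℤ))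
      then 1 else 0 := by
  unfold R
  rw [sum_split hab.ne, sum_split hab.ne (fun u => if ((u : ℕ) : ℤ) < s ∧ ((w u : ℕ) : ℤ) < t then 1 else 0)]
  have : ∑ u ∈ ({a, b} : Finset (Fin n))ᶜ, (if ((u : ℕ) : ℤ) < s ∧ (((w * Equiv.swap a b) u : ℕ) : ℤ) < t then (1:ℤ) else 0)
      = ∑ u ∈ ({a, b} : Finset (Fin n))ᶜ, (if ((u : ℕ) : ℤ) < s ∧ ((w u : ℕ) : ℤ) < t then (1:ℤ) else 0) := by
    apply Finset.sum_congr rfl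
    intro u hu
    simp only [Finset.mem_compl, Finset.mem_insert, Finset.mem_singleton, not_or] at hu
    rw [swap_c w a b u hu.1 hu.2]
  rw [this, swap_a, swap_b]
  have h1 : (a : ℕ) < b := hab
  have h2 : (w a : ℕ) < w b := hw
  split_ifs <;> omega

/-- double sum splitting -/
lemma dsum_split {n : ℕ} {a b : Fin n} (hab : a ≠ b) (g : Fin n → Fin n → ℤ) :
    ∑ c, ∑ d, g c d = (g a a + g a b + g b a + g b b) +
      ∑ c ∈ ({a, b} : Finset (Fin n))ᶜ, (g a c + g b c + g c a + g c b) +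
      ∑ c ∈ ({a, b} : Finset (Fin n))ᶜ, ∑ d ∈ ({a, b} : Finset (Fin n))ᶜ, g c d := by
  rw [sum_split hab, sum_split hab (g a), sum_split hab (g b)]
  rw [Finset.sum_congr rfl (fun c _ => sum_split hab (g c))]
  simp only [Finset.sum_add_distrib]
  ring

open Classical in
/-- Is the rectangle of the dots `c`, `d` an increasing pair hit by `L`? -/
def Hit {n : ℕ} (L : ℤ → ℤ → Prop) (v : Equiv.Perm (Fin n)) (c d : Fin n) : Prop :=
  ∃ s t : ℤ, ((c : ℕ) : ℤ) < s ∧ s ≤ ((d : ℕ) : ℤ) ∧ ((v c : ℕ) : ℤ) < t ∧ t ≤ ((v d : ℕ) : ℤ) ∧ L s t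

open Classical in
noncomputable def H {n : ℕ} (L : ℤ → ℤ → Prop) (v : Equiv.Perm (Fin n)) : ℤ :=
  ∑ c, ∑ d, if Hit L v c d then 1 else 0

/-- number of non-inversions -/
def nonInv {n : ℕ} (v : Equiv.Perm (Fin n)) : ℤ :=
  ∑ c : Fin n, ∑ d : Fin n, if c < d ∧ v c < v d then 1 else 0

lemma Hit.inc {n : ℕ} {L : ℤ → ℤ → Prop} {v : Equiv.Perm (Fin n)} {c d : Fin n}
    (h : Hit L v c d) : c < d ∧ v c < v d := by
  obtain ⟨s, t, h1, h2, h3, h4, -⟩ := h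
  constructor
  · show (c : ℕ) < d
    omega
  · show (v c : ℕ) < v d
    omega

lemma H_le_nonInv {n : ℕ} (L : ℤ → ℤ → Prop) (v : Equiv.Perm (Fin n)) : H L v ≤ nonInv v := by
  classical
  unfold H nonInv
  apply Finset.sum_le_sum; intro c _
  apply Finset.sum_le_sum; intro d _
  by_cases h : Hit L v c d
  · rw [if_pos h, if_pos h.inc]
  · rw [if_neg h]; split_ifs <;> norm_num

lemma hit_of_eq {n : ℕ} {L : ℤ → ℤ → Prop} {v : Equiv.Perm (Fin n)} (h : nonInv v ≤ H L v)
    {c d : Fin n} (hcd : c < d) (hv : v c < v d) : Hit L v c d := by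
  classical
  by_contra hc
  have : H L v < nonInv v := by
    unfold H nonInv
    have le : ∀ c d : Fin n, (if Hit L v c d then (1:ℤ) else 0) ≤ if c < d ∧ v c < v d then 1 else 0 := by
      intro c d
      by_cases h : Hit L v c d
      · rw [if_pos h, if_pos h.inc]
      · rw [if_neg h]; split_ifs <;> norm_num
    apply Finset.sum_lt_sum
    · intro c _
      exact Finset.sum_le_sum fun d _ => le c d
    · refine ⟨c, Finset.mem_univ _, ?_⟩
      apply Finset.sum_lt_sum (fun d _ => le c d)
      exact ⟨d, Finset.mem_univ _, by rw [if_neg hc, if_pos ⟨hcd, hv⟩]; norm_num⟩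
  omega

lemma H_mono_L {n : ℕ} {L L' : ℤ → ℤ → Prop} (h : ∀ s t, L s t → L' s t) (v : Equiv.Perm (Fin n)) :
    H L v ≤ H L' v := by
  classical
  unfold H
  apply Finset.sum_le_sum; intro c _
  apply Finset.sum_le_sum; intro d _
  by_cases hh : Hit L v c d
  · have : Hit L' v c d := by
      obtain ⟨s, t, h1, h2, h3, h4, h5⟩ := hh
      exact ⟨s, t, h1, h2, h3, h4, h _ _ h5⟩
    rw [if_pos hh, if_pos this]
  · rw [if_neg hh]; split_ifs <;> norm_num

lemma nonInv_swap {n : ℕ} (v : Equiv.Perm (Fin n)) {a b : Fin n} (hab : a < b) (hv : v a < v b) :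
    nonInv (v * Equiv.swap a b) + 1 ≤ nonInv v := by
  unfold nonInv
  rw [dsum_split hab.ne, dsum_split hab.ne (fun c d => if c < d ∧ v c < v d then (1:ℤ) else 0)]
  rw [swap_a, swap_b]
  have h3 : ∑ c ∈ ({a, b} : Finset (Fin n))ᶜ, ∑ d ∈ ({a, b} : Finset (Fin n))ᶜ,
        (if c < d ∧ (v * Equiv.swap a b) c < (v * Equiv.swap a b) d then (1:ℤ) else 0) =
      ∑ c ∈ ({a, b} : Finset (Fin n))ᶜ, ∑ d ∈ ({a, b} : Finset (Fin n))ᶜ,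
        (if c < d ∧ v c < v d then (1:ℤ) else 0) := by
    apply Finset.sum_congr rfl; intro c hc
    apply Finset.sum_congr rfl; intro d hd
    simp only [Finset.mem_compl, Finset.mem_insert, Finset.mem_singleton, not_or] at hc hd
    rw [swap_c v a b c hc.1 hc.2, swap_c v a b d hd.1 hd.2]
  have h2 : ∑ c ∈ ({a, b} : Finset (Fin n))ᶜ,
       ((if a < c ∧ v b < (v * Equiv.swap a b) c then (1:ℤ) else 0) +
        (if b < c ∧ v a < (v * Equiv.swap a b) c then (1:ℤ) else 0) +
        (if c < a ∧ (v * Equiv.swap a b) c < v b then (1:ℤ) else 0) +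
        (if c < b ∧ (v * Equiv.swap a b) c < v a then (1:ℤ) else 0)) ≤
      ∑ c ∈ ({a, b} : Finset (Fin n))ᶜ,
       ((if a < c ∧ v a < v c then (1:ℤ) else 0) +
        (if b < c ∧ v b < v c then (1:ℤ) else 0) +
        (if c < a ∧ v c < v a then (1:ℤ) else 0) +
        (if c < b ∧ v c < v b then (1:ℤ) else 0)) := by
    apply Finset.sum_le_sum; intro c hc
    simp only [Finset.mem_compl, Finset.mem_insert, Finset.mem_singleton, not_or] at hc
    rw [swap_c v a b c hc.1 hc.2]
    split_ifs <;> omega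
  have h4 : ¬ b < a := not_lt.2 hab.le
  have h5 : ¬ v b < v a := not_lt.2 hv.le
  simp only [lt_irrefl, false_and, and_false, hab, hv, h4, h5, if_true, if_false, and_true, true_and, and_self] at *
  rw [h3]
  linarith

end Tight
namespace Tight

lemma len_add_nonInv {n : ℕ} (v : Equiv.Perm (Fin n)) :
    (len v : ℤ) + nonInv v = ∑ c : Fin n, ∑ d : Fin n, if c < d then 1 else 0 := by
  unfold len nonInv
  rw [Finset.card_filter, Fintype.sum_prod_type]
  push_cast
  rw [← Finset.sum_add_distrib]
  apply Finset.sum_congr rfl; intro c _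
  rw [← Finset.sum_add_distrib]
  apply Finset.sum_congr rfl; intro d _
  by_cases h : c < d
  · have : v c ≠ v d := fun e => h.ne (v.injective e)
    simp only [h, true_and, if_true]
    split_ifs <;> omega
  · simp [h]

lemma nonInv_nonneg {n : ℕ} (v : Equiv.Perm (Fin n)) : 0 ≤ nonInv v := by
  unfold nonInv
  apply Finset.sum_nonneg; intro c _
  apply Finset.sum_nonneg; intro d _
  split_ifs <;> norm_num

def rle {n : ℕ} (v w : Equiv.Perm (Fin n)) : Prop := ∀ s t, R w s t ≤ R v s t

lemma rle_trans {n : ℕ} {u v w : Equiv.Perm (Fin n)} (h1 : rle u v) (h2 : rle v w) : rle u w :=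
  fun s t => (h2 s t).trans (h1 s t)

lemma R_row {n : ℕ} (v : Equiv.Perm (Fin n)) (a : Fin n) (t : ℤ) :
    R v (((a : ℕ) : ℤ) + 1) t = R v ((a : ℕ) : ℤ) t + if ((v a : ℕ) : ℤ) < t then 1 else 0 := by
  unfold R
  rw [← sub_eq_iff_eq_add', ← Finset.sum_sub_distrib, Finset.sum_eq_single a]
  · split_ifs <;> omega
  · intro b _ hb
    have : (b : ℕ) ≠ a := fun e => hb (Fin.ext e)
    split_ifs <;> omega
  · simp

lemma R_congr {n : ℕ} {v w : Equiv.Perm (Fin n)} {s : ℤ}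
    (h : ∀ u : Fin n, ((u : ℕ) : ℤ) < s → v u = w u) (t : ℤ) : R v s t = R w s t := by
  unfold R
  apply Finset.sum_congr rfl; intro u _
  by_cases hu : ((u : ℕ) : ℤ) < s
  · rw [h u hu]
  · simp [hu]

lemma first_diff {n : ℕ} {v w : Equiv.Perm (Fin n)} (h : v ≠ w) :
    ∃ a : Fin n, v a ≠ w a ∧ ∀ u : Fin n, ((u : ℕ) : ℤ) < ((a : ℕ) : ℤ) → v u = w u := by
  have : ∃ a, v a ≠ w a := by
    by_contra hc
    push Not at hc
    exact h (Equiv.ext hc)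
  obtain ⟨a, ha, hmin⟩ := WellFounded.has_min (wellFounded_lt (α := Fin n)) {a | v a ≠ w a} this
  refine ⟨a, ha, fun u hu => ?_⟩
  by_contra hc
  apply hmin u hc
  show (u : ℕ) < a
  omega

/-- cover data -/
def IsCov {n : ℕ} (v : Equiv.Perm (Fin n)) (a b : Fin n) : Prop :=
  a < b ∧ v a < v b ∧ ∀ c, a < c → c < b → v a < v c → v c < v b → False

lemma cover {n : ℕ} {v w : Equiv.Perm (Fin n)} (h : rle v w) (hne : v ≠ w) :
    ∃ a b, IsCov v a b ∧ ∀ s t : ℤ, ((a : ℕ) : ℤ) < s → s ≤ ((b : ℕ) : ℤ) →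
      ((v a : ℕ) : ℤ) < t → t ≤ ((v b : ℕ) : ℤ) → R w s t < R v s t := by
  obtain ⟨a, ha, hlow⟩ := first_diff hne
  have hR : ∀ t, R v ((a : ℕ) : ℤ) t = R w ((a : ℕ) : ℤ) t := R_congr hlow
  have hva : (v a : ℕ) ≠ w a := fun e => ha (Fin.ext e)
  have hlt : (v a : ℕ) < w a := by
    have h1 := h (((a : ℕ) : ℤ) + 1) (((w a : ℕ) : ℤ) + 1)
    rw [R_row, R_row, hR] at h1
    split_ifs at h1 <;> omega
  have key : ∀ s t : ℤ, ((a : ℕ) : ℤ) < s → ((v a : ℕ) : ℤ) < t → t ≤ ((w a : ℕ) : ℤ) →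
      (∀ b : Fin n, a < b → ((b : ℕ) : ℤ) < s → v a < v b → v b ≤ w a → False) →
      R w s t < R v s t := by
    intro s t hs ht ht2 hno
    have h1 := R_rect_pos w (s1 := ((a : ℕ) : ℤ)) (s2 := s) (t1 := t) (t2 := ((w a : ℕ) : ℤ) + 1) a
      le_rfl hs ht2 (by omega)
    have h2 : ¬ (0 < R v s (((w a : ℕ) : ℤ) + 1) + R v ((a : ℕ) : ℤ) t -
        R v ((a : ℕ) : ℤ) (((w a : ℕ) : ℤ) + 1) - R v s t) := by
      intro hp
      obtain ⟨u, ⟨h3, h4⟩, h5, h6⟩ := R_rect_dot v hs.le (by omega) hp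
      have hau : a ≠ u := by
        rintro rfl
        omega
      have hau' : (a : ℕ) ≠ u := fun e => hau (Fin.ext e)
      refine hno u ?_ h4 ?_ ?_
      · show (a : ℕ) < u
        omega
      · show (v a : ℕ) < v u
        omega
      · show (v u : ℕ) ≤ w a
        omega
    have h3 := h s (((w a : ℕ) : ℤ) + 1)
    rw [hR, hR] at h2
    omega
  have hex : ∃ b : Fin n, a < b ∧ v a < v b ∧ v b ≤ w a := by
    by_contra hc
    push Not at hc
    have han := a.2
    have := key n ((w a : ℕ) : ℤ) (by omega) (by omega) le_rfl
      (fun b h1 _ h3 h4 => absurd h4 (not_le.2 (hc b h1 h3)))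
    rw [R_high v w (Or.inl le_rfl)] at this
    omega
  obtain ⟨b, ⟨hb1, hb2, hb3⟩, hmin⟩ := WellFounded.has_min (wellFounded_lt (α := Fin n))
    {b | a < b ∧ v a < v b ∧ v b ≤ w a} hex
  refine ⟨a, b, ⟨hb1, hb2, ?_⟩, ?_⟩
  · intro c h1 h2 h3 h4
    exact hmin c ⟨h1, h3, (h4.le.trans hb3)⟩ h2
  · intro s t h1 h2 h3 h4
    have : (v b : ℕ) ≤ w a := hb3
    apply key s t h1 h3 (by omega)
    intro c g1 g2 g3 g4
    apply hmin c ⟨g1, g3, g4⟩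
    show (c : ℕ) < b
    omega

lemma rle_swap {n : ℕ} {v : Equiv.Perm (Fin n)} {a b : Fin n} (hab : a < b) (hv : v a < v b) :
    rle v (v * Equiv.swap a b) := by
  intro s t
  rw [R_swap v hab hv]
  split_ifs <;> omega

lemma swap_rle {n : ℕ} {v w : Equiv.Perm (Fin n)} {a b : Fin n} (h : rle v w)
    (hab : a < b) (hv : v a < v b)
    (hf : ∀ s t : ℤ, ((a : ℕ) : ℤ) < s → s ≤ ((b : ℕ) : ℤ) →
      ((v a : ℕ) : ℤ) < t → t ≤ ((v b : ℕ) : ℤ) → R w s t < R v s t) :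
    rle (v * Equiv.swap a b) w := by
  intro s t
  rw [R_swap v hab hv]
  have := h s t
  split_ifs with hc
  · have := hf s t hc.1.1 hc.1.2 hc.2.1 hc.2.2
    omega
  · omega

lemma cov_induct {n : ℕ} {w : Equiv.Perm (Fin n)} (P : Equiv.Perm (Fin n) → Prop) (hw : P w)
    (hs : ∀ v a b, rle v w → IsCov v a b → (∀ s t : ℤ, ((a : ℕ) : ℤ) < s → s ≤ ((b : ℕ) : ℤ) →
      ((v a : ℕ) : ℤ) < t → t ≤ ((v b : ℕ) : ℤ) → R w s t < R v s t) →
      rle (v * Equiv.swap a b) w → P (v * Equiv.swap a b) → P v) :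
    ∀ v, rle v w → P v := by
  have main : ∀ (k : ℕ) (v : Equiv.Perm (Fin n)), nonInv v ≤ k → rle v w → P v := by
    intro k
    induction k with
    | zero =>
      intro v hk h
      by_cases hne : v = w
      · rw [hne]; exact hw
      · obtain ⟨a, b, hc, hf⟩ := cover h hne
        have := nonInv_swap v hc.1 hc.2.1
        have := nonInv_nonneg (v * Equiv.swap a b)
        omega
    | succ k ih =>
      intro v hk h
      by_cases hne : v = w
      · rw [hne]; exact hw
      · obtain ⟨a, b, hc, hf⟩ := cover h hne
        have h1 := nonInv_swap v hc.1 hc.2.1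
        have h2 := swap_rle h hc.1 hc.2.1 hf
        exact hs v a b h hc hf h2 (ih _ (by push_cast at hk; omega) h2)
  intro v h
  exact main (nonInv v).toNat v (by omega) h

lemma bruhat_step {n : ℕ} {v : Equiv.Perm (Fin n)} {a b : Fin n} (hab : a < b) (hv : v a < v b) :
    bruhatLE v (v * Equiv.swap a b) := by
  apply Relation.ReflTransGen.single
  refine ⟨_, ⟨a, b, hab.ne, rfl⟩, rfl, ?_⟩
  have h1 := len_add_nonInv v
  have h2 := len_add_nonInv (v * Equiv.swap a b)
  have := nonInv_swap v hab hv
  omega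

lemma rle_of_step {n : ℕ} {v : Equiv.Perm (Fin n)} {a b : Fin n} (hab : a < b)
    (h : len v < len (v * Equiv.swap a b)) : rle v (v * Equiv.swap a b) := by
  by_cases hv : v a < v b
  · exact rle_swap hab hv
  · exfalso
    have hne : v a ≠ v b := fun e => hab.ne (v.injective e)
    have hlt : (v * Equiv.swap a b) a < (v * Equiv.swap a b) b := by
      rw [swap_a, swap_b]
      exact lt_of_le_of_ne (not_lt.1 hv) hne.symm
    have := nonInv_swap (v * Equiv.swap a b) hab hlt
    rw [mul_assoc, Equiv.swap_mul_self, mul_one] at this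
    have h1 := len_add_nonInv v
    have h2 := len_add_nonInv (v * Equiv.swap a b)
    omega

lemma rle_of_bruhat {n : ℕ} {v w : Equiv.Perm (Fin n)} (h : bruhatLE v w) : rle v w := by
  induction h with
  | refl => exact fun s t => le_rfl
  | tail h1 h2 ih =>
    refine rle_trans ih ?_
    obtain ⟨t, ⟨i, j, hij, rfl⟩, rfl, hl⟩ := h2
    rcases lt_or_gt_of_ne hij with h | h
    · exact rle_of_step h hl
    · rw [Equiv.swap_comm] at hl ⊢
      exact rle_of_step h hl

lemma bruhat_of_rle {n : ℕ} {v w : Equiv.Perm (Fin n)} (h : rle v w) : bruhatLE v w := by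
  refine cov_induct (w := w) (fun v => bruhatLE v w) Relation.ReflTransGen.refl ?_ v h
  intro v a b _ hc _ _ ih
  exact (bruhat_step hc.1 hc.2.1).trans ih

end Tight
namespace Tight

lemma ite_count {P1 P2 Q1 Q2 : Prop} [Decidable P1] [Decidable P2] [Decidable Q1] [Decidable Q2]
    (h1 : P1 → Q1 ∨ Q2) (h2 : P2 → Q1) (h3 : P2 → Q2) :
    (if P1 then (1:ℤ) else 0) + (if P2 then 1 else 0) ≤ (if Q1 then 1 else 0) + (if Q2 then 1 else 0) := by
  by_cases P1 <;> by_cases P2 <;> by_cases Q1 <;> by_cases Q2 <;> simp_all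

lemma ite_count' {P1 P2 Q1 Q2 : Prop} [Decidable P1] [Decidable P2] [Decidable Q1] [Decidable Q2]
    (h1 : ¬ P2) (h2 : Q1) (h3 : Q2) :
    (if P1 then (1:ℤ) else 0) + (if P2 then 1 else 0) + 1 ≤ (if Q1 then 1 else 0) + (if Q2 then 1 else 0) := by
  by_cases P1 <;> simp_all

section
variable {n : ℕ} {L : ℤ → ℤ → Prop} {v : Equiv.Perm (Fin n)} {a b : Fin n}

lemma swap_SE (hab : a < b) (hv : v a < v b) (hT : ¬ Hit L v a b) (c : Fin n)
    (hca : c ≠ a) (hcb : c ≠ b) :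
    (Hit L v a c → Hit L (v * Equiv.swap a b) a c ∨ Hit L (v * Equiv.swap a b) b c) ∧
    (Hit L v b c → Hit L (v * Equiv.swap a b) a c) ∧
    (Hit L v b c → Hit L (v * Equiv.swap a b) b c) := by
  unfold Hit
  rw [swap_a, swap_b, swap_c v a b c hca hcb]
  have h1 : (a : ℕ) < b := hab
  have h2 : (v a : ℕ) < v b := hv
  refine ⟨?_, ?_, ?_⟩
  · rintro ⟨s, t, g1, g2, g3, g4, g5⟩
    by_cases hs : s ≤ ((b : ℕ) : ℤ)
    · by_cases ht : t ≤ ((v b : ℕ) : ℤ)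
      · exact absurd ⟨s, t, g1, hs, g3, ht, g5⟩ hT
      · exact Or.inl ⟨s, t, g1, g2, by omega, g4, g5⟩
    · exact Or.inr ⟨s, t, by omega, g2, g3, g4, g5⟩
  · rintro ⟨s, t, g1, g2, g3, g4, g5⟩
    exact ⟨s, t, by omega, g2, by omega, g4, g5⟩
  · rintro ⟨s, t, g1, g2, g3, g4, g5⟩
    exact ⟨s, t, by omega, g2, by omega, g4, g5⟩

lemma swap_NW (hab : a < b) (hv : v a < v b) (hT : ¬ Hit L v a b) (c : Fin n)
    (hca : c ≠ a) (hcb : c ≠ b) :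
    (Hit L v c b → Hit L (v * Equiv.swap a b) c a ∨ Hit L (v * Equiv.swap a b) c b) ∧
    (Hit L v c a → Hit L (v * Equiv.swap a b) c a) ∧
    (Hit L v c a → Hit L (v * Equiv.swap a b) c b) := by
  unfold Hit
  rw [swap_a, swap_b, swap_c v a b c hca hcb]
  have h1 : (a : ℕ) < b := hab
  have h2 : (v a : ℕ) < v b := hv
  refine ⟨?_, ?_, ?_⟩
  · rintro ⟨s, t, g1, g2, g3, g4, g5⟩
    by_cases hs : ((a : ℕ) : ℤ) < s
    · by_cases ht : ((v a : ℕ) : ℤ) < t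
      · exact absurd ⟨s, t, hs, g2, ht, g4, g5⟩ hT
      · exact Or.inr ⟨s, t, g1, g2, by omega, by omega, g5⟩
    · exact Or.inl ⟨s, t, by omega, by omega, g3, g4, g5⟩
  · rintro ⟨s, t, g1, g2, g3, g4, g5⟩
    exact ⟨s, t, by omega, by omega, by omega, by omega, g5⟩
  · rintro ⟨s, t, g1, g2, g3, g4, g5⟩
    exact ⟨s, t, by omega, by omega, by omega, by omega, g5⟩

open Classical in
lemma H_split (L : ℤ → ℤ → Prop) (v : Equiv.Perm (Fin n)) (hab : a < b) (hv : v a < v b)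
    (hT : ¬ Hit L v a b) :
    H L (v * Equiv.swap a b) - H L v = 
      ∑ c ∈ ({a, b} : Finset (Fin n))ᶜ,
       ((((if Hit L (v * Equiv.swap a b) a c then (1:ℤ) else 0) +
        (if Hit L (v * Equiv.swap a b) b c then (1:ℤ) else 0)) -
         ((if Hit L v a c then (1:ℤ) else 0) + (if Hit L v b c then (1:ℤ) else 0))) +
       (((if Hit L (v * Equiv.swap a b) c a then (1:ℤ) else 0) +
        (if Hit L (v * Equiv.swap a b) c b then (1:ℤ) else 0)) -
         ((if Hit L v c b then (1:ℤ) else 0) + (if Hit L v c a then (1:ℤ) else 0)))) := by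
  have h3 : ∑ c ∈ ({a, b} : Finset (Fin n))ᶜ, ∑ d ∈ ({a, b} : Finset (Fin n))ᶜ,
        (if Hit L (v * Equiv.swap a b) c d then (1:ℤ) else 0) =
      ∑ c ∈ ({a, b} : Finset (Fin n))ᶜ, ∑ d ∈ ({a, b} : Finset (Fin n))ᶜ,
        (if Hit L v c d then (1:ℤ) else 0) := by
    apply Finset.sum_congr rfl; intro c hc
    apply Finset.sum_congr rfl; intro d hd
    simp only [Finset.mem_compl, Finset.mem_insert, Finset.mem_singleton, not_or] at hc hd
    unfold Hit
    rw [swap_c v a b c hc.1 hc.2, swap_c v a b d hd.1 hd.2]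
  have e1 : ∀ (u : Equiv.Perm (Fin n)) c, ¬ Hit L u c c := fun u c h => lt_irrefl _ h.inc.1
  have e2 : ∀ (u : Equiv.Perm (Fin n)), ¬ Hit L u b a := fun u h => not_lt.2 hab.le h.inc.1
  have e3 : ¬ Hit L (v * Equiv.swap a b) a b := fun h => by
    have := h.inc.2
    rw [swap_a, swap_b] at this
    exact not_lt.2 hv.le this
  unfold H
  rw [dsum_split hab.ne, dsum_split hab.ne (fun c d => if Hit L v c d then (1:ℤ) else 0), h3]
  simp only [if_neg (e1 _ _), if_neg (e2 _), if_neg e3, if_neg hT]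
  simp only [Finset.sum_add_distrib, Finset.sum_sub_distrib]
  ring

lemma H_swap (hab : a < b) (hv : v a < v b) (hT : ¬ Hit L v a b) :
    H L v ≤ H L (v * Equiv.swap a b) := by
  classical
  rw [← sub_nonneg, H_split L v hab hv hT]
  apply Finset.sum_nonneg; intro c hc
  simp only [Finset.mem_compl, Finset.mem_insert, Finset.mem_singleton, not_or] at hc
  obtain ⟨a1, a2, a3⟩ := swap_SE hab hv hT c hc.1 hc.2
  obtain ⟨b1, b2, b3⟩ := swap_NW hab hv hT c hc.1 hc.2
  have := ite_count a1 a2 a3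
  have := ite_count b1 b2 b3
  linarith

lemma H_swap_strict (hab : a < b) (hv : v a < v b) (hT : ¬ Hit L v a b) (c : Fin n)
    (hca : c ≠ a) (hcb : c ≠ b) (h1 : ¬ Hit L v c a)
    (h2 : Hit L (v * Equiv.swap a b) c a) (h3 : Hit L (v * Equiv.swap a b) c b) :
    H L v + 1 ≤ H L (v * Equiv.swap a b) := by
  classical
  suffices 0 < H L (v * Equiv.swap a b) - H L v by linarith
  rw [H_split L v hab hv hT]
  apply Finset.sum_pos'
  · intro c hc
    simp only [Finset.mem_compl, Finset.mem_insert, Finset.mem_singleton, not_or] at hc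
    obtain ⟨a1, a2, a3⟩ := swap_SE hab hv hT c hc.1 hc.2
    obtain ⟨b1, b2, b3⟩ := swap_NW hab hv hT c hc.1 hc.2
    have := ite_count a1 a2 a3
    have := ite_count b1 b2 b3
    linarith
  · refine ⟨c, by simp [hca, hcb], ?_⟩
    obtain ⟨a1, a2, a3⟩ := swap_SE hab hv hT c hca hcb
    have := ite_count a1 a2 a3
    have := ite_count' (P1 := Hit L v c b) h1 h2 h3
    linarith
end

/-- the locus of equality -/
def Lv {n : ℕ} (v w : Equiv.Perm (Fin n)) (s t : ℤ) : Prop := R v s t = R w s t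

lemma H_mono {n : ℕ} {L : ℤ → ℤ → Prop} {u v : Equiv.Perm (Fin n)} (h : rle u v)
    (hL : ∀ s t, L s t → R u s t = R v s t) : H L u ≤ H L v := by
  refine cov_induct (w := v) (fun u => (∀ s t, L s t → R u s t = R v s t) → H L u ≤ H L v)
    (fun _ => le_rfl) ?_ u h hL
  intro u a b _ hc hf h2 ih hL
  have hT : ¬ Hit L u a b := by
    rintro ⟨s, t, g1, g2, g3, g4, g5⟩
    have := hf s t g1 g2 g3 g4
    rw [hL s t g5] at this
    exact lt_irrefl _ this
  refine (H_swap hc.1 hc.2.1 hT).trans (ih ?_)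
  intro s t hst
  rw [R_swap u hc.1 hc.2.1, if_neg, sub_zero, hL s t hst]
  rintro ⟨⟨g1, g2⟩, g3, g4⟩
  exact hT ⟨s, t, g1, g2, g3, g4, hst⟩

def Smooth {n : ℕ} (w v : Equiv.Perm (Fin n)) : Prop := rle v w ∧ nonInv w ≤ H (Lv v w) v

lemma Smooth.up {n : ℕ} {w x v : Equiv.Perm (Fin n)} (h : Smooth w x) (h1 : rle x v) (h2 : rle v w) :
    Smooth w v := by
  have hL : ∀ s t, Lv x w s t → R x s t = R v s t := by
    intro s t hst
    have := h1 s t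
    have := h2 s t
    unfold Lv at hst
    omega
  refine ⟨h2, h.2.trans ((H_mono h1 hL).trans (H_mono_L ?_ v))⟩
  intro s t hst
  have := hL s t hst
  unfold Lv at *
  omega

lemma Smooth.stuck {n : ℕ} {w x : Equiv.Perm (Fin n)} (h : Smooth w x) {c d : Fin n}
    (hcd : c < d) (hw : w c < w d) : Hit (Lv x w) w c d :=
  hit_of_eq (h.2.trans (H_mono h.1 (fun _ _ h => h))) hcd hw

/-- Lemma (1') -/
lemma Smooth.one {n : ℕ} {w v : Equiv.Perm (Fin n)} (h : Smooth w v) {c a b : Fin n}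
    (hca : c < a) (hab : a < b) (vab : v a < v b)
    (f1 : ¬ Hit (Lv v w) v c a) (f2 : ¬ Hit (Lv v w) v a b)
    {l1 l2 m1 m2 : ℤ} (hl : Lv v w l1 l2) (hm : Lv v w m1 m2)
    (p1 : ((c : ℕ) : ℤ) < l1) (p2 : l1 ≤ ((a : ℕ) : ℤ)) (p3 : ((v c : ℕ) : ℤ) < l2)
    (p4 : l2 ≤ ((v b : ℕ) : ℤ))
    (q1 : ((c : ℕ) : ℤ) < m1) (q2 : m1 ≤ ((b : ℕ) : ℤ)) (q3 : ((v c : ℕ) : ℤ) < m2)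
    (q4 : m2 ≤ ((v a : ℕ) : ℤ)) : False := by
  have hc1 : c ≠ a := hca.ne
  have hc2 : c ≠ b := (hca.trans hab).ne
  have s1 := H_swap_strict hab vab f2 c hc1 hc2 f1
    ⟨l1, l2, p1, p2, by rw [swap_c v a b c hc1 hc2]; exact p3, by rw [swap_a]; exact p4, hl⟩
    ⟨m1, m2, q1, q2, by rw [swap_c v a b c hc1 hc2]; exact q3, by rw [swap_b]; exact q4, hm⟩
  have r1 : rle (v * Equiv.swap a b) w := by
    apply swap_rle h.1 hab vab
    intro s t g1 g2 g3 g4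
    refine lt_of_le_of_ne (h.1 s t) ?_
    intro e
    exact f2 ⟨s, t, g1, g2, g3, g4, e.symm⟩
  have s2 : H (Lv v w) (v * Equiv.swap a b) ≤ H (Lv v w) w := by
    apply H_mono r1
    intro s t hst
    rw [R_swap v hab vab, if_neg, sub_zero]
    · exact hst
    · rintro ⟨⟨g1, g2⟩, g3, g4⟩
      exact f2 ⟨s, t, g1, g2, g3, g4, hst⟩
  have s3 := H_le_nonInv (Lv v w) w
  have := h.2
  omega

end Tight
namespace Tight

def Clean (L : ℤ → ℤ → Prop) (l1 l2 m1 m2 : ℤ) : Prop :=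
  l1 < m1 ∧ m2 < l2 ∧ L l1 l2 ∧ L m1 m2 ∧
    ∀ s t, l1 ≤ s → s ≤ m1 → m2 ≤ t → t ≤ l2 → L s t → (s = l1 ∧ t = l2) ∨ (s = m1 ∧ t = m2)

def HypH (Dot L : ℤ → ℤ → Prop) : Prop :=
  ∀ s1 s2 t1 t2, s1 < s2 → t1 < t2 → L s1 t2 → L s2 t1 → (¬ L s1 t1 ∨ ¬ L s2 t2) →
    ∃ u v, Dot u v ∧ s1 ≤ u ∧ u < s2 ∧ t1 ≤ v ∧ v < t2

lemma nw {Dot L : ℤ → ℤ → Prop} (hH : HypH Dot L) {B : ℤ} (hB : ∀ s t, s ≤ B ∨ t ≤ B → L s t)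
    {l1 l2 m1 m2 : ℤ} (hc : Clean L l1 l2 m1 m2) :
    ∃ c cv l1' l2' m1' m2', Dot c cv ∧ Clean L l1' l2' m1' m2' ∧ c < l1' ∧ cv < m2' ∧
      c < l1 ∧ cv < m2 ∧ m1' ≤ m1 ∧ l2' ≤ l2 ∧
      ∀ s t, c < s → s < m1' → cv < t → t < l2' → ¬ L s t := by
  obtain ⟨hlm, hml, hl, hm, hcl⟩ := hc
  have hcorner : ¬ L l1 m2 := by
    intro h
    have := hcl l1 m2 le_rfl hlm.le le_rfl hml.le h
    omega
  obtain ⟨lcol, ⟨k1, k2⟩, k3⟩ := Int.exists_greatest_of_bdd (P := fun t => t < m2 ∧ L l1 t)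
    ⟨m2, fun z hz => hz.1.le⟩ ⟨min B (m2 - 1), by omega, hB _ _ (by omega)⟩
  obtain ⟨s', ⟨j1, t', j2, j3, j4⟩, j5⟩ := Int.exists_greatest_of_bdd
    (P := fun s => s < l1 ∧ ∃ t, lcol < t ∧ t ≤ m2 ∧ L s t)
    ⟨l1, fun z hz => hz.1.le⟩ ⟨min B (l1 - 1), by omega, m2, k1, le_rfl, hB _ _ (by omega)⟩
  have hrow : ∀ t, lcol < t → t ≤ m2 → ¬ L l1 t := by
    intro t h1 h2 h3
    by_cases e : t = m2
    · rw [e] at h3; exact hcorner h3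
    · have := k3 t ⟨by omega, h3⟩
      omega
  obtain ⟨c, cv, hdot, c1, c2, c3, c4⟩ := hH s' l1 lcol t' j1 j2 j4 k2 (Or.inr (hrow t' j2 j3))
  have hfree : ∀ s t, c < s → s ≤ l1 → cv < t → t ≤ m2 → ¬ L s t := by
    intro s t h1 h2 h3 h4 h5
    by_cases e : s = l1
    · rw [e] at h5
      exact hrow t (by omega) h4 h5
    · have := j5 s ⟨by omega, t, by omega, h4, h5⟩
      omega
  obtain ⟨p, ⟨p1, p2, t0, p3, p4, p5⟩, p6⟩ := Int.exists_least_of_bdd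
    (P := fun s => l1 < s ∧ s ≤ m1 ∧ ∃ t, cv < t ∧ t ≤ m2 ∧ L s t)
    ⟨l1, fun z hz => hz.1.le⟩ ⟨m1, hlm, le_rfl, m2, by omega, le_rfl, hm⟩
  obtain ⟨m2', ⟨r1, r2, r3⟩, r4⟩ := Int.exists_greatest_of_bdd
    (P := fun t => cv < t ∧ t ≤ m2 ∧ L p t) ⟨m2, fun z hz => hz.2.1⟩ ⟨t0, p3, p4, p5⟩
  obtain ⟨q, ⟨q1, q2, s0, q3, q4, q5⟩, q6⟩ := Int.exists_least_of_bdd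
    (P := fun t => m2 < t ∧ t ≤ l2 ∧ ∃ s, c < s ∧ s ≤ l1 ∧ L s t)
    ⟨m2, fun z hz => hz.1.le⟩ ⟨l2, hml, le_rfl, l1, by omega, le_rfl, hl⟩
  obtain ⟨l1', ⟨u1, u2, u3⟩, u4⟩ := Int.exists_greatest_of_bdd
    (P := fun s => c < s ∧ s ≤ l1 ∧ L s q) ⟨l1, fun z hz => hz.2.1⟩ ⟨s0, q3, q4, q5⟩
  refine ⟨c, cv, l1', q, p, m2', hdot, ⟨by omega, by omega, u3, r3, ?_⟩, u1, r1, c2, by omega, p2, q2, ?_⟩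
  · intro s t h1 h2 h3 h4 h5
    by_cases hs : s ≤ l1
    · by_cases ht : t ≤ m2
      · exact absurd h5 (hfree s t (by omega) hs (by omega) ht)
      · have := q6 t ⟨by omega, by omega, s, by omega, hs, h5⟩
        have e : t = q := by omega
        subst e
        have := u4 s ⟨by omega, hs, h5⟩
        omega
    · by_cases ht : t ≤ m2
      · have := p6 s ⟨by omega, by omega, t, by omega, ht, h5⟩
        have e : s = p := by omega
        subst e
        have := r4 t ⟨by omega, ht, h5⟩
        omega
      · have := hcl s t (by omega) (by omega) (by omega) (by omega) h5
        omega
  · intro s t h1 h2 h3 h4 h5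
    by_cases hs : s ≤ l1
    · by_cases ht : t ≤ m2
      · exact hfree s t (by omega) hs (by omega) ht h5
      · have := q6 t ⟨by omega, by omega, s, by omega, hs, h5⟩
        omega
    · by_cases ht : t ≤ m2
      · have := p6 s ⟨by omega, by omega, t, by omega, ht, h5⟩
        omega
      · have := hcl s t (by omega) (by omega) (by omega) (by omega) h5
        omega

lemma se {Dot L : ℤ → ℤ → Prop} (hH : HypH Dot L) {B : ℤ} (hB : ∀ s t, B ≤ s ∨ B ≤ t → L s t)
    {l1 l2 m1 m2 : ℤ} (hc : Clean L l1 l2 m1 m2) :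
    ∃ b bv l1' l2' m1' m2', Dot b bv ∧ Clean L l1' l2' m1' m2' ∧ m1' ≤ b ∧ l2' ≤ bv ∧
      m1 ≤ b ∧ l2 ≤ bv ∧ l1 ≤ l1' ∧ m2 ≤ m2' ∧
      ∀ s t, l1' < s → s ≤ b → m2' < t → t ≤ bv → ¬ L s t := by
  have hH' : HypH (fun u v => Dot (-1 - u) (-1 - v)) (fun s t => L (-s) (-t)) := by
    intro s1 s2 t1 t2 h1 h2 h3 h4 h5
    obtain ⟨u, v, g1, g2, g3, g4, g5⟩ := hH (-s2) (-s1) (-t2) (-t1) (by omega) (by omega) h4 h3 h5.symm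
    refine ⟨-1 - u, -1 - v, ?_, by omega, by omega, by omega, by omega⟩
    simpa using g1
  obtain ⟨hlm, hml, hl, hm, hcl⟩ := hc
  have hc' : Clean (fun s t => L (-s) (-t)) (-m1) (-m2) (-l1) (-l2) := by
    refine ⟨by omega, by omega, by simpa using hm, by simpa using hl, ?_⟩
    intro s t h1 h2 h3 h4 h5
    have := hcl (-s) (-t) (by omega) (by omega) (by omega) (by omega) h5
    omega
  obtain ⟨c, cv, l1', l2', m1', m2', d1, ⟨e1, e2, e3, e4, e5⟩, d3, d4, d5, d6, d7, d8, d9⟩ :=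
    nw hH' (B := -B) (fun s t h => hB _ _ (by omega)) hc'
  refine ⟨-1 - c, -1 - cv, -m1', -m2', -l1', -l2', d1, ⟨by omega, by omega, e4, e3, ?_⟩,
    by omega, by omega, by omega, by omega, by omega, by omega, ?_⟩
  · intro s t h1 h2 h3 h4 h5
    have := e5 (-s) (-t) (by omega) (by omega) (by omega) (by omega) (by simpa using h5)
    omega
  · intro s t h1 h2 h3 h4 h5
    exact d9 (-s) (-t) (by omega) (by omega) (by omega) (by omega) (by simpa using h5)

lemma Lv_low {n : ℕ} (v w : Equiv.Perm (Fin n)) (s t : ℤ) (h : s ≤ 0 ∨ t ≤ 0) : Lv v w s t := by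
  unfold Lv
  rw [R_low v h, R_low w h]

lemma Lv_high {n : ℕ} (v w : Equiv.Perm (Fin n)) (s t : ℤ) (h : (n : ℤ) ≤ s ∨ (n : ℤ) ≤ t) :
    Lv v w s t := R_high v w h

lemma hypH_of_rle {n : ℕ} {x w : Equiv.Perm (Fin n)} (h : rle x w) :
    HypH (fun u v => ∃ c : Fin n, u = ((c : ℕ) : ℤ) ∧ v = ((x c : ℕ) : ℤ)) (Lv x w) := by
  intro s1 s2 t1 t2 h1 h2 h3 h4 h5
  have g1 := h s1 t1
  have g2 := h s2 t2
  have g3 := R_rect_nonneg w h1.le h2.le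
  have : 0 < R x s2 t2 + R x s1 t1 - R x s1 t2 - R x s2 t1 := by
    unfold Lv at *
    omega
  obtain ⟨u, ⟨k1, k2⟩, k3, k4⟩ := R_rect_dot x h1.le h2.le this
  exact ⟨_, _, ⟨u, rfl, rfl⟩, k1, k2, k3, k4⟩

lemma smooth_star {n : ℕ} {w : Equiv.Perm (Fin n)} : ∀ (k : ℕ) (x : Equiv.Perm (Fin n)),
    nonInv x ≤ k → Smooth w x → ∀ l1 l2 m1 m2, ¬ Clean (Lv x w) l1 l2 m1 m2 := by
  intro k
  induction k using Nat.strong_induction_on with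
  | _ k ih =>
  intro x hk hx l1 l2 m1 m2 hcl
  have hH := hypH_of_rle hx.1
  obtain ⟨_, _, l1, l2, m1, m2, ⟨c, rfl, rfl⟩, hP1, c1, c2, -, -, -, -, cfree⟩ :=
    nw hH (Lv_low x w) hcl
  obtain ⟨_, _, l1', l2', m1', m2', ⟨b, rfl, rfl⟩, hP2, b1, b2, b3, b4, b5, b6, bfree⟩ :=
    se hH (Lv_high x w) hP1
  obtain ⟨e1, e2, e3, e4, e5⟩ := hP2
  obtain ⟨_, _, ⟨a, rfl, rfl⟩, a1, a2, a3, a4⟩ := hH l1' m1' m2' l2' e1 e2 e3 e4 (Or.inl (by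
    intro h
    have := e5 l1' m2' le_rfl e1.le le_rfl e2.le h
    omega))
  have hab : a < b := by
    show (a : ℕ) < b
    omega
  have hxab : x a < x b := by
    show (x a : ℕ) < x b
    omega
  have hT : ¬ Hit (Lv x w) x a b := by
    rintro ⟨s, t, g1, g2, g3, g4, g5⟩
    exact bfree s t (by omega) g2 (by omega) g4 g5
  obtain ⟨f1, f2, f3, f4, f5⟩ := hP1
  by_cases hcase : ((a : ℕ) : ℤ) < m1 ∧ ((x a : ℕ) : ℤ) < l2
  · refine hx.one (c := c) (a := a) (b := b) ?_ hab hxab ?_ hT f3 f4 c1 (by omega) (by omega) b4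
      (by omega) b3 c2 (by omega)
    · show (c : ℕ) < a
      omega
    · rintro ⟨s, t, g1, g2, g3, g4, g5⟩
      exact cfree s t (by omega) (by omega) (by omega) (by omega) g5
  · have r1 : rle (x * Equiv.swap a b) w := by
      apply swap_rle hx.1 hab hxab
      intro s t g1 g2 g3 g4
      refine lt_of_le_of_ne (hx.1 s t) ?_
      intro e
      exact hT ⟨s, t, g1, g2, g3, g4, e.symm⟩
    have hLe : ∀ s t, s ≤ m1 → t ≤ l2 → (Lv (x * Equiv.swap a b) w s t ↔ Lv x w s t) := by
      intro s t h1 h2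
      unfold Lv
      rw [R_swap x hab hxab, if_neg, sub_zero]
      omega
    have hni := nonInv_swap x hab hxab
    have hnn := nonInv_nonneg (x * Equiv.swap a b)
    refine ih (nonInv (x * Equiv.swap a b)).toNat (by omega) (x * Equiv.swap a b) (by omega)
      (hx.up (rle_swap hab hxab) r1) l1 l2 m1 m2 ⟨f1, f2, ?_, ?_, ?_⟩
    · rw [hLe _ _ f1.le le_rfl]; exact f3
    · rw [hLe _ _ le_rfl f2.le]; exact f4
    · intro s t h1 h2 h3 h4 h5
      rw [hLe _ _ h2 h4] at h5
      exact f5 s t h1 h2 h3 h4 h5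

lemma lemU {n : ℕ} {L : ℤ → ℤ → Prop} (hstar : ∀ l1 l2 m1 m2, ¬ Clean L l1 l2 m1 m2)
    (hB : ∀ s t, (n : ℤ) ≤ s ∨ (n : ℤ) ≤ t → L s t) {v z : Equiv.Perm (Fin n)}
    (hv : ∀ c d, c < d → v c < v d → Hit L v c d) (hL : ∀ s t, L s t → R v s t = R z s t)
    {a : Fin n} (hlow : ∀ u : Fin n, ((u : ℕ) : ℤ) < ((a : ℕ) : ℤ) → v u = z u)
    (ha : (v a : ℕ) < z a) : False := by
  have hR : ∀ t, R v ((a : ℕ) : ℤ) t = R z ((a : ℕ) : ℤ) t := R_congr hlow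
  have ha2 := a.2
  have hrow : ∀ t, ((v a : ℕ) : ℤ) < t → t ≤ ((z a : ℕ) : ℤ) →
      R v (((a : ℕ) : ℤ) + 1) t = R z (((a : ℕ) : ℤ) + 1) t + 1 := by
    intro t h1 h2
    rw [R_row, R_row, hR, if_pos h1, if_neg (by omega)]
    omega
  obtain ⟨s, ⟨s1, t0, s2, s3, s4⟩, s5⟩ := Int.exists_least_of_bdd
    (P := fun s => ((a : ℕ) : ℤ) < s ∧ ∃ t, ((v a : ℕ) : ℤ) < t ∧ t ≤ ((z a : ℕ) : ℤ) ∧ L s t)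
    ⟨((a : ℕ) : ℤ), fun z hz => hz.1.le⟩
    ⟨n, by omega, ((z a : ℕ) : ℤ), by omega, le_rfl, hB _ _ (by omega)⟩
  obtain ⟨t, ⟨t1, t2, t3⟩, t4⟩ := Int.exists_greatest_of_bdd
    (P := fun t => ((v a : ℕ) : ℤ) < t ∧ t ≤ ((z a : ℕ) : ℤ) ∧ L s t)
    ⟨((z a : ℕ) : ℤ), fun z hz => hz.2.1⟩ ⟨t0, s2, s3, s4⟩
  obtain ⟨e, ⟨e1, e2⟩, e3⟩ := Int.exists_least_of_bdd
    (P := fun e => t < e ∧ L s e) ⟨t, fun z hz => hz.1.le⟩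
    ⟨max n (t + 1), by omega, hB _ _ (by omega)⟩
  have hez : ((z a : ℕ) : ℤ) < e := by
    by_contra hc
    have := t4 e ⟨by omega, by omega, e2⟩
    omega
  have hreg : ∀ s' t', ((a : ℕ) : ℤ) < s' → s' < s → ((v a : ℕ) : ℤ) < t' → t' < e → ¬ L s' t' := by
    intro s0 t0 h1 h2 h3 h4 h5
    obtain ⟨s', ⟨g1, g2, t00, g3, g4, g5⟩, g6⟩ := Int.exists_greatest_of_bdd
      (P := fun s' => ((a : ℕ) : ℤ) < s' ∧ s' < s ∧ ∃ t', ((v a : ℕ) : ℤ) < t' ∧ t' < e ∧ L s' t')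
      ⟨s, fun z hz => hz.2.1.le⟩ ⟨s0, h1, h2, t0, h3, h4, h5⟩
    obtain ⟨t', ⟨k1, k2, k3⟩, k4⟩ := Int.exists_least_of_bdd
      (P := fun t' => ((v a : ℕ) : ℤ) < t' ∧ t' < e ∧ L s' t')
      ⟨((v a : ℕ) : ℤ), fun z hz => hz.1.le⟩ ⟨t00, g3, g4, g5⟩
    have hz : ((z a : ℕ) : ℤ) < t' := by
      by_contra hc
      have := s5 s' ⟨g1, t', k1, by omega, k3⟩
      omega
    refine hstar s' t' s t ⟨g2, by omega, k3, t3, ?_⟩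
    intro p q h1 h2 h3 h4 h5
    by_cases p1 : p = s
    · right
      subst p1
      refine ⟨rfl, ?_⟩
      by_contra hc
      have := e3 q ⟨by omega, h5⟩
      omega
    · left
      have := g6 p ⟨by omega, by omega, q, by omega, by omega, h5⟩
      have p2 : p = s' := by omega
      subst p2
      have := k4 q ⟨by omega, by omega, h5⟩
      exact ⟨rfl, by omega⟩
  have h1 := hrow t t1 t2
  have h2 : R v (((a : ℕ) : ℤ) + 1) e = R z (((a : ℕ) : ℤ) + 1) e := by
    rw [R_row, R_row, hR, if_pos (by omega), if_pos (by omega)]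
  have h3 := hL s t t3
  have h4 := hL s e e2
  have h5 := R_rect_nonneg z (s1 := ((a : ℕ) : ℤ) + 1) (s2 := s) (t1 := t) (t2 := e) (by omega) e1.le
  obtain ⟨b, ⟨b1, b2⟩, b3, b4⟩ := R_rect_dot v (s1 := ((a : ℕ) : ℤ) + 1) (s2 := s) (t1 := t) (t2 := e)
    (by omega) e1.le (by omega)
  obtain ⟨p, q, p1, p2, p3, p4, p5⟩ := hv a b (by show (a : ℕ) < b; omega)
    (by show (v a : ℕ) < v b; omega)
  exact hreg p q p1 (by omega) p3 (by omega) p5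

lemma lemU_eq {n : ℕ} {L : ℤ → ℤ → Prop} (hstar : ∀ l1 l2 m1 m2, ¬ Clean L l1 l2 m1 m2)
    (hB : ∀ s t, (n : ℤ) ≤ s ∨ (n : ℤ) ≤ t → L s t) {v z : Equiv.Perm (Fin n)}
    (hv : ∀ c d, c < d → v c < v d → Hit L v c d) (hz : ∀ c d, c < d → z c < z d → Hit L z c d)
    (hL : ∀ s t, L s t → R v s t = R z s t) : v = z := by
  by_contra hne
  obtain ⟨a, ha, hlow⟩ := first_diff hne
  have : (v a : ℕ) ≠ z a := fun e => ha (Fin.ext e)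
  rcases lt_or_gt_of_ne this with h | h
  · exact lemU hstar hB hv hL hlow h
  · exact lemU hstar hB hz (fun s t h => (hL s t h).symm) (fun u hu => (hlow u hu).symm) h

lemma climb {n : ℕ} {L : ℤ → ℤ → Prop} {w : Equiv.Perm (Fin n)}
    (hstar : ∀ l1 l2 m1 m2, ¬ Clean L l1 l2 m1 m2)
    (hB : ∀ s t, (n : ℤ) ≤ s ∨ (n : ℤ) ≤ t → L s t)
    (hw : ∀ c d, c < d → w c < w d → Hit L w c d) : ∀ (k : ℕ) (y : Equiv.Perm (Fin n)),
    nonInv y ≤ k → (∀ s t, L s t → R y s t = R w s t) → bruhatLE y w := by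
  intro k
  induction k using Nat.strong_induction_on with
  | _ k ih =>
  intro y hk hy
  by_cases hst : ∀ c d, c < d → y c < y d → Hit L y c d
  · rw [lemU_eq hstar hB hst hw hy]
    exact Relation.ReflTransGen.refl
  · push Not at hst
    obtain ⟨a, b, hab, hyab, hT⟩ := hst
    have hni := nonInv_swap y hab hyab
    have hnn := nonInv_nonneg (y * Equiv.swap a b)
    refine (bruhat_step hab hyab).trans (ih (nonInv (y * Equiv.swap a b)).toNat (by omega) _
      (by omega) ?_)
    intro s t hs
    rw [R_swap y hab hyab, if_neg, sub_zero, hy s t hs]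
    rintro ⟨⟨g1, g2⟩, g3, g4⟩
    exact hT ⟨s, t, g1, g2, g3, g4, hs⟩

lemma swap_inj {n : ℕ} {c d c' d' : Fin n} (h : c < d) (h' : c' < d')
    (e : Equiv.swap c d = Equiv.swap c' d') : c = c' ∧ d = d' := by
  have e1 : Equiv.swap c' d' c = d := by rw [← e, Equiv.swap_apply_left]
  by_cases g1 : c = c'
  · subst g1
    rw [Equiv.swap_apply_left] at e1
    exact ⟨rfl, e1.symm⟩
  · by_cases g2 : c = d'
    · subst g2
      rw [Equiv.swap_apply_right] at e1
      subst e1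
      exact absurd h (not_lt.2 h'.le)
    · rw [Equiv.swap_apply_of_ne_of_ne g1 g2] at e1
      exact absurd e1 h.ne

lemma smooth_of {n : ℕ} {x w : Equiv.Perm (Fin n)} (hxw : bruhatLE x w)
    (hsmooth : (Set.ncard {t : Equiv.Perm (Fin n) |
        IsTransposition t ∧ bruhatLT x (x * t) ∧ bruhatLE (x * t) w} : ℤ) =
      (len w : ℤ) - len x) : Smooth w x := by
  classical
  have hr := rle_of_bruhat hxw
  refine ⟨hr, ?_⟩
  set F : Finset (Fin n × Fin n) := Finset.univ.filter
    (fun p => (p.1 < p.2 ∧ x p.1 < x p.2) ∧ ¬ Hit (Lv x w) x p.1 p.2) with hF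
  have hcard : (F.card : ℤ) = nonInv x - H (Lv x w) x := by
    rw [hF, Finset.card_filter, Fintype.sum_prod_type]
    unfold nonInv H
    push_cast
    rw [← Finset.sum_sub_distrib]
    apply Finset.sum_congr rfl; intro c _
    rw [← Finset.sum_sub_distrib]
    apply Finset.sum_congr rfl; intro d _
    by_cases h : Hit (Lv x w) x c d
    · simp [h, h.inc]
    · simp [h]
  have hle : F.card ≤ Set.ncard {t : Equiv.Perm (Fin n) |
        IsTransposition t ∧ bruhatLT x (x * t) ∧ bruhatLE (x * t) w} := by
    rw [← Set.ncard_coe_finset]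
    apply Set.ncard_le_ncard_of_injOn (fun p : Fin n × Fin n => Equiv.swap p.1 p.2) _ _ (Set.toFinite _)
    · rintro ⟨c, d⟩ hp
      simp only [hF, Finset.coe_filter, Finset.mem_univ, true_and, Set.mem_setOf_eq] at hp
      obtain ⟨⟨h1, h2⟩, h3⟩ := hp
      refine ⟨⟨c, d, h1.ne, rfl⟩, ⟨bruhat_step h1 h2, ?_⟩, ?_⟩
      · intro e
        have := congrArg (fun f : Equiv.Perm (Fin n) => f c) e
        simp only [swap_a] at this
        exact h2.ne this
      · apply bruhat_of_rle
        apply swap_rle hr h1 h2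
        intro s t g1 g2 g3 g4
        refine lt_of_le_of_ne (hr s t) ?_
        intro e
        exact h3 ⟨s, t, g1, g2, g3, g4, e.symm⟩
    · rintro ⟨c, d⟩ hp ⟨c', d'⟩ hp' e
      simp only [hF, Finset.coe_filter, Finset.mem_univ, true_and, Set.mem_setOf_eq] at hp hp'
      obtain ⟨r1, r2⟩ := swap_inj hp.1.1 hp'.1.1 e
      rw [r1, r2]
  have h1 := len_add_nonInv x
  have h2 := len_add_nonInv w
  omega

end Tight

theorem stmt14 (n : ℕ) (x w : Equiv.Perm (Fin n)) (hxw : bruhatLE x w)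
    (hsmooth : (Set.ncard {t : Equiv.Perm (Fin n) |
        IsTransposition t ∧ bruhatLT x (x * t) ∧ bruhatLE (x * t) w} : ℤ) =
      (len w : ℤ) - len x) :
    ∀ y : Equiv.Perm (Fin n),
      (∀ i j : ℕ, i ≤ n → j ≤ n → rk x i j = rk w i j → rk y i j = rk w i j) →
      bruhatLE y w := by
  intro y hy
  have hs := Tight.smooth_of hxw hsmooth
  have hnn := Tight.nonInv_nonneg x
  have hnn' := Tight.nonInv_nonneg y
  refine Tight.climb (L := Tight.Lv x w)
    (Tight.smooth_star (Tight.nonInv x).toNat x (by omega) hs)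
    (Tight.Lv_high x w) (fun c d h1 h2 => hs.stuck h1 h2) (Tight.nonInv y).toNat y (by omega) ?_
  intro s t hst
  by_cases h1 : s ≤ 0 ∨ t ≤ 0
  · rw [Tight.R_low y h1, Tight.R_low w h1]
  by_cases h2 : (n : ℤ) ≤ s ∨ (n : ℤ) ≤ t
  · exact Tight.R_high y w h2
  lift s to ℕ using (by omega)
  lift t to ℕ using (by omega)
  unfold Tight.Lv at hst
  rw [Tight.R_eq_rk, Tight.R_eq_rk] at hst ⊢
  have := hy s t (by omega) (by omega) (by exact_mod_cast hst)
  exact_mod_cast this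
end
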